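/- A graph G is a brick if and only if G is 3-connected and G - x - y has a perfect matching for every pair of distinct vertices x, y of G. -/

import Mathlib

open Classical in
/-- A finite multigraph: loops are forbidden, multiple edges are allowed. -/
structure Multigraph where
  V : Type
  E : Type
  [fintV : Fintype V]
  [fintE : Fintype E]
  ends : E → Sym2 V
  no_loops : ∀ e, ¬ (ends e).IsDiag

attribute [instance] Multigraph.fintV Multigraph.fintE

namespace Multigraph

variable (G : Multigraph)

/-- Vertex `v` is incident with edge `e`. -/
def Inc (v : G.V) (e : G.E) : Prop := v ∈ G.ends e

/-- Adjacency of vertices. -/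
def Adj (u v : G.V) : Prop := u ≠ v ∧ ∃ e, G.ends e = s(u, v)

/-- A multigraph is connected. -/
def Connected : Prop := Nonempty G.V ∧ ∀ u v : G.V, Relation.ReflTransGen G.Adj u v

/-- A set of edges is a perfect matching: every vertex is covered exactly once. -/
def IsPerfectMatching (M : Set G.E) : Prop :=
  ∀ v : G.V, ∃! e, e ∈ M ∧ G.Inc v e

/-- Matching covered: nontrivial, connected, every edge lies in a perfect matching. -/
def MatchingCovered : Prop :=
  2 ≤ Nat.card G.V ∧ G.Connected ∧ ∀ e : G.E, ∃ M, G.IsPerfectMatching M ∧ e ∈ M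

/-- Degree of a vertex. -/
noncomputable def degree (v : G.V) : ℕ := Nat.card {e : G.E // G.Inc v e}

/-- Maximum degree `Δ(G)`. -/
noncomputable def maxDegree : ℕ := Finset.univ.sup G.degree

/-- The graph obtained by deleting the edge `e`. -/
noncomputable def deleteEdge (e : G.E) : Multigraph where
  V := G.V
  E := {f : G.E // f ≠ e}
  fintE := Fintype.ofFinite _
  ends f := G.ends f.1
  no_loops f := G.no_loops f.1

/-- An edge of `G` is removable if `G - e` is matching covered. -/
noncomputable def Removable (e : G.E) : Prop := (G.deleteEdge e).MatchingCovered

/-- The graph obtained by deleting a set of vertices (and all incident edges). -/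
noncomputable def deleteVerts (S : Set G.V) : Multigraph where
  V := {v : G.V // v ∉ S}
  E := {e : G.E // ∀ v ∈ G.ends e, v ∉ S}
  fintV := Fintype.ofFinite _
  fintE := Fintype.ofFinite _
  ends e := (G.ends e.1).attachWith e.2
  no_loops e h := G.no_loops e.1 (by
    have := (Sym2.isDiag_map Subtype.val_injective).mpr h
    simpa using this)

/-- Two-connectedness: at least three vertices, and deleting any vertex
leaves a connected graph. -/
noncomputable def TwoConnected : Prop :=
  3 ≤ Nat.card G.V ∧ ∀ v : G.V, (G.deleteVerts {v}).Connected

/-- Three-connectedness: at least four vertices, and deleting any two distinct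
vertices leaves a connected graph. -/
noncomputable def ThreeConnected : Prop :=
  4 ≤ Nat.card G.V ∧ ∀ u v : G.V, u ≠ v → (G.deleteVerts {u, v}).Connected

/-- The cut `∂(X)`: edges with exactly one end in `X`. -/
def cut (X : Set G.V) : Set G.E :=
  {e | ∃ u ∈ X, ∃ w ∈ Xᶜ, G.ends e = s(u, w)}

/-- A tight cut: a cut (with both shores nonempty) met by every perfect matching
in exactly one edge. -/
def IsTightCut (X : Set G.V) : Prop :=
  X.Nonempty ∧ Xᶜ.Nonempty ∧
    ∀ M : Set G.E, G.IsPerfectMatching M → ∃! e, e ∈ M ∧ e ∈ G.cut X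

/-- A cut `∂(X)` is trivial if one of its shores is a singleton. -/
def TrivialShore (X : Set G.V) : Prop := (∃ v, X = {v}) ∨ (∃ v, Xᶜ = {v})

/-- `G` is bipartite. -/
def Bipartite : Prop :=
  ∃ c : G.V → Bool, ∀ (e : G.E) (a b : G.V), G.ends e = s(a, b) → c a ≠ c b

/-- The subgraph of `G` induced by `X` is bipartite. -/
def BipartiteOn (X : Set G.V) : Prop :=
  ∃ c : G.V → Bool, ∀ (e : G.E) (a b : G.V),
    G.ends e = s(a, b) → a ∈ X → b ∈ X → c a ≠ c b

lemma Sym2.exists_eq_mk {α : Type*} (z : Sym2 α) : ∃ a b, z = s(a, b) := by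
  induction z using Sym2.ind with
  | _ x y => exact ⟨x, y, rfl⟩

open Classical in
/-- Contraction `G/X`: the shore `X` is shrunk to a single new vertex.
Edges with both ends in `X` disappear. -/
noncomputable def contract (X : Set G.V) : Multigraph where
  V := {v : G.V // v ∉ X} ⊕ Unit
  E := {e : G.E // ¬ ∀ v ∈ G.ends e, v ∈ X}
  fintV := Fintype.ofFinite _
  fintE := Fintype.ofFinite _
  ends e := (G.ends e.1).map
    (fun v => if h : v ∈ X then Sum.inr () else Sum.inl ⟨v, h⟩)
  no_loops := by
    rintro ⟨e, he⟩ hdiag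
    obtain ⟨a, b, hab⟩ := Sym2.exists_eq_mk (G.ends e)
    have hne : a ≠ b := by
      have := G.no_loops e
      rw [hab, Sym2.mk_isDiag_iff] at this
      exact this
    simp only [hab, Sym2.map_pair_eq, Sym2.mk_isDiag_iff] at hdiag
    by_cases ha : a ∈ X <;> by_cases hb : b ∈ X
    · exact he (by
        rw [hab]; intro v hv
        rcases Sym2.mem_iff.mp hv with h | h <;> subst h <;> assumption)
    · rw [dif_pos ha, dif_neg hb] at hdiag; simp at hdiag
    · rw [dif_neg ha, dif_pos hb] at hdiag; simp at hdiag
    · rw [dif_neg ha, dif_neg hb] at hdiag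
      simp only [Sum.inl.injEq, Subtype.mk.injEq] at hdiag
      exact hne hdiag

/-- A brick: a nonbipartite matching covered graph all of whose tight cuts are
trivial. -/
def IsBrick : Prop :=
  G.MatchingCovered ∧ ¬ G.Bipartite ∧ ∀ X : Set G.V, G.IsTightCut X → G.TrivialShore X

/-- A brace: a bipartite matching covered graph all of whose tight cuts are
trivial. -/
def IsBrace : Prop :=
  G.MatchingCovered ∧ G.Bipartite ∧ ∀ X : Set G.V, G.IsTightCut X → G.TrivialShore X

/-- `BrickCount G n` holds if some tight cut decomposition of `G` produces
exactly `n` bricks.  (By Lovász's theorem the number `n` is independent of the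
decomposition.) -/
inductive BrickCount : (G : Multigraph) → ℕ → Prop
  | brick (G : Multigraph) (h : G.IsBrick) : BrickCount G 1
  | brace (G : Multigraph) (h : G.IsBrace) : BrickCount G 0
  | cut (G : Multigraph) (X : Set G.V) (ht : G.IsTightCut X) (hnt : ¬ G.TrivialShore X)
      {n m : ℕ} (h1 : BrickCount (G.contract X) n) (h2 : BrickCount (G.contract Xᶜ) m) :
      BrickCount G (n + m)

/-- A near-brick: a matching covered graph whose tight cut decompositions
have exactly one brick. -/
def IsNearBrick : Prop := G.MatchingCovered ∧ BrickCount G 1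

/-- A single ear of length at least 3: an odd path of length `k ≥ 3` all of whose
internal vertices have degree two. -/
def HasLongSingleEar : Prop :=
  ∃ (k : ℕ) (v : Fin (k + 1) → G.V) (e : Fin k → G.E),
    Odd k ∧ 3 ≤ k ∧ Function.Injective v ∧ Function.Injective e ∧
    (∀ i : Fin k, G.ends (e i) = s(v i.castSucc, v i.succ)) ∧
    (∀ i : Fin (k + 1), i ≠ 0 → i ≠ Fin.last k → G.degree (v i) = 2)

/-- Irreducible: no single ear of length three or more. -/
def Irreducible : Prop := ¬ G.HasLongSingleEar

/-- Isomorphism of multigraphs. -/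
def IsIso (G H : Multigraph) : Prop :=
  ∃ (φ : G.V ≃ H.V) (ψ : G.E ≃ H.E), ∀ e, H.ends (ψ e) = (G.ends e).map φ

end Multigraph

open Multigraph

/-- The complete graph `K₂`. -/
def K2 : Multigraph where
  V := Fin 2
  E := Unit
  ends _ := s(0, 1)
  no_loops _ := by simp [Sym2.mk_isDiag_iff]

/-- The complete graph `K₄`. -/
noncomputable def K4 : Multigraph where
  V := Fin 4
  E := {p : Sym2 (Fin 4) // ¬ p.IsDiag}
  fintE := Fintype.ofFinite _
  ends p := p.1
  no_loops p := p.2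

/-- The cycle `C₄`. -/
def C4 : Multigraph where
  V := ZMod 4
  E := ZMod 4
  ends i := s(i, i + 1)
  no_loops i := by
    have h : ∀ j : ZMod 4, j ≠ j + 1 := by decide
    simpa [Sym2.mk_isDiag_iff] using h i

/-- `C̄₆`, the complement of the 6-cycle (the triangular prism). -/
noncomputable def C6bar : Multigraph where
  V := ZMod 6
  E := {p : Sym2 (ZMod 6) // ¬ p.IsDiag ∧ ∀ a b : ZMod 6, p = s(a, b) → b ≠ a + 1 ∧ a ≠ b + 1}
  fintE := Fintype.ofFinite _
  ends p := p.1
  no_loops p := p.2.1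

set_option linter.unusedSectionVars false

section Matching

open Finset Function

section Abstract

variable {V : Type*}

/-- If `t` is a fixed point of the involution `N`, then the orbit of `t` under the group generated
by the involutions `m` and `N` contains at most one fixed point of `m`. -/
theorem exists_orbit_unique_fixed {m N : V → V} (hm : Involutive m) (hN : Involutive N) {t : V}
    (ht : N t = t) :
    ∃ K : Set V, t ∈ K ∧ (∀ x ∈ K, m x ∈ K) ∧ (∀ x ∈ K, N x ∈ K) ∧
      (∀ U : Set V, t ∈ U → (∀ x ∈ U, m x ∈ U) → (∀ x ∈ U, N x ∈ U) → K ⊆ U) ∧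
      ∀ x ∈ K, ∀ y ∈ K, m x = x → m y = y → x = y := by
  set a : Equiv.Perm V := hm.toPerm with ha
  set b : Equiv.Perm V := hN.toPerm with hb
  have haa : a⁻¹ = a := inv_eq_of_mul_eq_one_left (by ext x; simp [ha, hm x])
  have hbb : b⁻¹ = b := inv_eq_of_mul_eq_one_left (by ext x; simp [hb, hN x])
  have hb1 : b * b = 1 := mul_eq_one_iff_eq_inv.mpr hbb.symm
  have hbt : b t = t := ht
  set σ : Equiv.Perm V := a * b with hσ
  have hconj : b * σ * b⁻¹ = σ⁻¹ := by
    rw [hσ, mul_inv_rev, haa, hbb, mul_assoc, mul_assoc, hb1, mul_one]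
  have hbσ (i : ℤ) : b ((σ ^ i) t) = (σ ^ (-i)) t := by
    have h : b * σ ^ i * b⁻¹ = σ ^ (-i) := by
      rw [← conj_zpow, hconj, inv_zpow, zpow_neg]
    rw [← h, Equiv.Perm.mul_apply, Equiv.Perm.mul_apply, hbb, hbt]
  have haσ (i : ℤ) : a ((σ ^ i) t) = (σ ^ (1 - i)) t := by
    have h : a = σ * b := by rw [hσ, mul_assoc, hb1, mul_one]
    calc a ((σ ^ i) t) = σ (b ((σ ^ i) t)) := congrArg (· ((σ ^ i) t)) h
      _ = _ := by rw [hbσ, ← Equiv.Perm.mul_apply, ← zpow_one_add, sub_eq_add_neg]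
  refine ⟨{x | ∃ i : ℤ, x = (σ ^ i) t}, ⟨0, by simp⟩, ?_, ?_, ?_, ?_⟩
  · rintro _ ⟨i, rfl⟩
    exact ⟨1 - i, haσ i⟩
  · rintro _ ⟨i, rfl⟩
    exact ⟨-i, hbσ i⟩
  · rintro U htU hmU hNU _ ⟨i, rfl⟩
    have h1 (x : V) (hx : x ∈ U) : σ x ∈ U := hmU _ (hNU _ hx)
    have h2 (x : V) (hx : x ∈ U) : σ⁻¹ x ∈ U := by
      rw [hσ, mul_inv_rev, haa, hbb]
      exact hNU _ (hmU _ hx)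
    induction i using Int.induction_on with
    | zero => simpa
    | succ n ih =>
      rw [add_comm, zpow_add, zpow_one, Equiv.Perm.mul_apply]
      exact h1 _ ih
    | pred n ih =>
      rw [sub_eq_add_neg, add_comm, zpow_add, zpow_neg_one, Equiv.Perm.mul_apply]
      exact h2 _ ih
  · rintro _ ⟨i, rfl⟩ _ ⟨j, rfl⟩ hi hj
    replace hi : (σ ^ (1 - i)) t = (σ ^ i) t := (haσ i).symm.trans hi
    replace hj : (σ ^ (1 - j)) t = (σ ^ j) t := (haσ j).symm.trans hj
    have key (k l : ℤ) (h : (σ ^ k) t = (σ ^ l) t) :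
        σ ^ (l - k) ∈ MulAction.stabilizer (Equiv.Perm V) t := by
      rw [MulAction.mem_stabilizer_iff, Equiv.Perm.smul_def, sub_eq_add_neg, add_comm, zpow_add,
        Equiv.Perm.mul_apply, ← h, ← Equiv.Perm.mul_apply, ← zpow_add, neg_add_cancel, zpow_zero,
        Equiv.Perm.one_apply]
    have h : σ ^ (j - i) ∈ MulAction.stabilizer (Equiv.Perm V) t := by
      have e : σ ^ (j - i) = (σ ^ (j - (1 - j))) ^ i * ((σ ^ (i - (1 - i))) ^ j)⁻¹ := by
        rw [← zpow_mul, ← zpow_mul, ← zpow_neg, ← zpow_add]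
        ring_nf
      rw [e]
      exact mul_mem (zpow_mem (key _ _ hj) _) (inv_mem (zpow_mem (key _ _ hi) _))
    rw [MulAction.mem_stabilizer_iff, Equiv.Perm.smul_def] at h
    calc (σ ^ i) t = (σ ^ i) ((σ ^ (j - i)) t) := by rw [h]
      _ = (σ ^ j) t := by rw [← Equiv.Perm.mul_apply, ← zpow_add, add_sub_cancel]

variable [Fintype V] [DecidableEq V]

/-- The indicator that the cut `∂(S)` separates `u` from `v`. -/
def sep (S : Finset V) (u v : V) : ℤ := if (u ∈ S ↔ v ∈ S) then 0 else 1

theorem sep_comm (S : Finset V) (u v : V) : sep S u v = sep S v u := by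
  simp only [sep, iff_comm]

/-- The weight (each edge counted twice) of a matching, given as an involution. -/
def weight (w : V → V → ℕ) (m : V → V) : ℤ := ∑ v, (w v (m v) : ℤ)

/-- The matching obtained from `m` by dropping the edges of weight zero. -/
def prune (w : V → V → ℕ) (m : V → V) (v : V) : V := if w v (m v) = 0 then v else m v

theorem prune_involutive {w : V → V → ℕ} (hw : ∀ u v, w u v = w v u) {m : V → V}
    (hm : Involutive m) : Involutive (prune w m) := by
  intro v
  by_cases h : w v (m v) = 0
  · simp [prune, h]
  · have h' : w (m v) v ≠ 0 := by rwa [hw]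
    simp [prune, h, hm v, h']

theorem weight_prune {w : V → V → ℕ} (hw0 : ∀ v, w v v = 0) (m : V → V) :
    weight w (prune w m) = weight w m := by
  refine Finset.sum_congr rfl fun v _ => ?_
  by_cases h : w v (m v) = 0 <;> simp [prune, h, hw0]

theorem pos_of_prune_ne {w : V → V → ℕ} {m : V → V} {v : V} (h : prune w m v ≠ v) :
    0 < w v (prune w m v) := by
  by_cases h' : w v (m v) = 0
  · simp [prune, h'] at h
  · simpa [prune, h'] using Nat.pos_of_ne_zero h'

theorem even_card_of_involution {m : V → V} (hm : Involutive m) {T : Finset V}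
    (hT : ∀ x ∈ T, m x ∈ T ∧ m x ≠ x) : Even #T := by
  have h : ∑ _x ∈ T, (1 : ZMod 2) = 0 :=
    Finset.sum_involution (fun x _ => m x) (fun _ _ => by decide) (fun x hx _ => (hT x hx).2)
      (fun x hx => (hT x hx).1) (fun x _ => hm x)
  rw [Finset.sum_const, nsmul_one] at h
  exact (ZMod.natCast_eq_zero_iff_even).mp h

/-- The vertices of `U` covered by the matching `m`. -/
def covered (U : Finset V) (m : V → V) : Finset V := {v ∈ U | m v ≠ v}

/-- The component of `t` in the union of the matchings `m` and `N` is swapped between them. -/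
theorem exists_swapped_matching {w : V → V → ℕ} {U : Finset V}
    (hU : ∀ u ∈ U, ∀ v, 0 < w u v → v ∈ U) {m N : V → V} (hm : Involutive m) (hN : Involutive N)
    (hmw : ∀ v, m v ≠ v → 0 < w v (m v)) (hNw : ∀ v, N v ≠ v → 0 < w v (N v))
    (hmax : ∀ m', Involutive m' → weight w m' ≤ weight w N)
    {t u v : V} (htU : t ∈ U) (ht : N t = t) (huv : u ≠ v) (hu : m u = u) (hv : m v = v) :
    ∃ m', Involutive m' ∧ (∀ x, m' x ≠ x → 0 < w x (m' x)) ∧ m' t = t ∧ (m' u = u ∨ m' v = v) ∧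
      weight w m ≤ weight w m' ∧ #(covered U m') ≤ #(covered U m) := by
  classical
  obtain ⟨K, htK, hmK, hNK, hmin, huniq⟩ := exists_orbit_unique_fixed hm hN ht
  have hclosed {f : V → V} (hf : ∀ x, f x ≠ x → 0 < w x (f x)) : ∀ x ∈ (U : Set V), f x ∈ U := by
    intro x hx
    by_cases h : f x = x
    · rwa [h]
    · exact hU x hx _ (hf x h)
  have hKU : K ⊆ U := hmin U htU (hclosed hmw) (hclosed hNw)
  have hswap {f g : V → V} (hf : Involutive f) (hg : Involutive g) (hfK : ∀ x ∈ K, f x ∈ K)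
      (hgK : ∀ x ∈ K, g x ∈ K) : Involutive (fun x => if x ∈ K then f x else g x) := by
    intro x
    by_cases hx : x ∈ K
    · simp [hx, hfK x hx, hf x]
    · have : g x ∉ K := fun h => hx (by simpa [hg x] using hgK _ h)
      simp [hx, this, hg x]
  refine ⟨fun x => if x ∈ K then N x else m x, hswap hN hm hNK hmK, ?_, by simp [htK, ht], ?_,
    ?_, ?_⟩
  · intro x hx
    by_cases hxK : x ∈ K
    · simp only [hxK, if_true] at hx ⊢
      exact hNw x hx
    · simp only [hxK, if_false] at hx ⊢
      exact hmw x hx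
  · by_cases huK : u ∈ K
    · have hvK : v ∉ K := fun h => huv (huniq u huK v h hu hv)
      simp [hvK, hv]
    · simp [huK, hu]
  · have h := hmax _ (hswap hm hN hmK hNK)
    have e : weight w (fun x => if x ∈ K then N x else m x) +
        weight w (fun x => if x ∈ K then m x else N x) = weight w m + weight w N := by
      simp only [weight, ← Finset.sum_add_distrib]
      refine Finset.sum_congr rfl fun x _ => ?_
      by_cases hx : x ∈ K <;> simp [hx, add_comm]
    linarith
  · have hfix : #{x ∈ U | x ∈ K ∧ m x = x} ≤ #{x ∈ U | x ∈ K ∧ N x = x} := by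
      calc #{x ∈ U | x ∈ K ∧ m x = x} ≤ 1 := by
            rw [Finset.card_le_one]
            intro x hx y hy
            simp only [Finset.mem_filter] at hx hy
            exact huniq x hx.2.1 y hy.2.1 hx.2.2 hy.2.2
        _ ≤ _ := Finset.card_pos.mpr ⟨t, by simp [htU, htK, ht]⟩
    have e (f : V → V) : (#(covered U f) : ℤ) = #{x ∈ U | x ∉ K ∧ f x ≠ x} +
        (#{x ∈ U | x ∈ K} - #{x ∈ U | x ∈ K ∧ f x = x}) := by
      simp only [covered, Finset.card_filter, Nat.cast_sum, ← Finset.sum_add_distrib,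
        ← Finset.sum_sub_distrib]
      refine Finset.sum_congr rfl fun x _ => ?_
      by_cases hx : x ∈ K <;> by_cases hf : f x = x <;> simp [hx, hf]
    have e1 : #{x ∈ U | x ∉ K ∧ (if x ∈ K then N x else m x) ≠ x} = #{x ∈ U | x ∉ K ∧ m x ≠ x} := by
      congr 1
      refine Finset.filter_congr fun x _ => ?_
      by_cases hx : x ∈ K <;> simp [hx]
    have e2 : #{x ∈ U | x ∈ K ∧ (if x ∈ K then N x else m x) = x} = #{x ∈ U | x ∈ K ∧ N x = x} := by
      congr 1
      refine Finset.filter_congr fun x _ => ?_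
      by_cases hx : x ∈ K <;> simp [hx]
    have h1 := e (fun x => if x ∈ K then N x else m x)
    have h2 := e m
    rw [e1, e2] at h1
    omega

/-- The support graph of a symmetric weight function. -/
def supportGraph (w : V → V → ℕ) (hw : ∀ u v, w u v = w v u) : SimpleGraph V where
  Adj u v := u ≠ v ∧ 0 < w u v
  symm := ⟨fun u v h => ⟨h.1.symm, hw u v ▸ h.2⟩⟩
  loopless := ⟨fun _ h => h.1 rfl⟩

/-- Subtract one from all positive weights within `U`. -/
def lowerOn (U : Finset V) (w : V → V → ℕ) (u v : V) : ℕ :=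
  if u ∈ U ∧ v ∈ U then w u v - 1 else w u v

theorem weight_lowerOn {w : V → V → ℕ} {U : Finset V} (hU : ∀ u ∈ U, ∀ v, 0 < w u v → v ∈ U)
    (hw0 : ∀ v, w v v = 0) {m : V → V} (hmw : ∀ v, m v ≠ v → 0 < w v (m v)) :
    weight (lowerOn U w) m = weight w m - #(covered U m) := by
  have e : (#(covered U m) : ℤ) = ∑ v, if v ∈ U ∧ m v ≠ v then 1 else 0 := by
    rw [Finset.sum_boole, covered]
    congr 2
    ext v
    simp
  rw [e, weight, weight, ← Finset.sum_sub_distrib]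
  refine Finset.sum_congr rfl fun v _ => ?_
  by_cases hv : v ∈ U
  · by_cases h : m v = v
    · simp [lowerOn, h, hw0]
    · have := hmw v h
      simp only [lowerOn, hv, hU v hv _ this, h, and_self, if_true, ne_eq, not_false_eq_true]
      omega
  · simp [lowerOn, hv]

theorem not_pos_of_missed_of_maximal {w : V → V → ℕ} (hw : ∀ u v, w u v = w v u)
    (hw0 : ∀ v, w v v = 0) {U : Finset V} {n : ℕ} {m : V → V} (hm : Involutive m)
    (hmw : ∀ v, m v ≠ v → 0 < w v (m v))
    (hmax : ∀ m', Involutive m' → (∀ v, m' v ≠ v → 0 < w v (m' v)) →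
      (n + 1) * weight w m' - n * #(covered U m') ≤ (n + 1) * weight w m - n * #(covered U m))
    {a b : V} (ha : m a = a) (hb : m b = b) : ¬ 0 < w a b := by
  intro hab
  have hne : a ≠ b := by rintro rfl; simp [hw0] at hab
  set m' : V → V := fun x => if x = a then b else if x = b then a else m x with hm'
  have hmx {x : V} (hxa : x ≠ a) (hxb : x ≠ b) : m x ≠ a ∧ m x ≠ b :=
    ⟨fun h => hxa (by rw [← hm x, h, ha]), fun h => hxb (by rw [← hm x, h, hb])⟩
  have hinv : Involutive m' := by
    intro x
    by_cases hxa : x = a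
    · simp [hm', hxa]
    · by_cases hxb : x = b
      · simp [hm', hxb]
      · simp [hm', hxa, hxb, hmx hxa hxb, hm x]
  have hpos : ∀ x, m' x ≠ x → 0 < w x (m' x) := by
    intro x hx
    by_cases hxa : x = a
    · simpa [hm', hxa] using hab
    · by_cases hxb : x = b
      · simpa [hm', hxb, hne.symm, hw b a] using hab
      · simp only [hm', hxa, hxb, if_false] at hx ⊢
        exact hmw x hx
  have hwt : weight w m + 2 ≤ weight w m' := by
    have e : (2 : ℤ) = ∑ x : V, ((if x = a then 1 else 0) + (if x = b then 1 else 0)) := by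
      simp [Finset.sum_add_distrib]
    rw [e, weight, weight, ← Finset.sum_add_distrib]
    refine Finset.sum_le_sum fun x _ => ?_
    by_cases hxa : x = a
    · simp only [hm', hxa, if_true, ha, hw0, hne, if_false]
      omega
    · by_cases hxb : x = b
      · simp only [hm', hxb, if_true, hb, hw0, hne.symm, if_false, hw b a]
        omega
      · simp [hm', hxa, hxb]
  have hcov : #(covered U m') ≤ #(covered U m) + 2 := by
    have hsub : covered U m' ⊆ insert a (insert b (covered U m)) := by
      intro x hx
      simp only [covered, Finset.mem_filter, Finset.mem_insert] at hx ⊢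
      by_cases hxa : x = a
      · exact Or.inl hxa
      · by_cases hxb : x = b
        · exact Or.inr (Or.inl hxb)
        · exact Or.inr (Or.inr ⟨hx.1, by simpa [hm', hxa, hxb] using hx.2⟩)
    have h1 := Finset.card_le_card hsub
    have h2 := Finset.card_insert_le a (insert b (covered U m))
    have h3 := Finset.card_insert_le b (covered U m)
    omega
  have h := hmax m' hinv hpos
  have h1 : (n : ℤ) * #(covered U m') ≤ n * (#(covered U m) + 2) := by
    gcongr
    exact_mod_cast hcov
  have h2 : ((n : ℤ) + 1) * (weight w m + 2) ≤ (n + 1) * weight w m' := by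
    gcongr
  linarith

/-- If every vertex of the component `U` is missed by a maximum weight matching, then a matching
maximizing the perturbed weight `(n + 1) w - n |covered U|` misses at most one vertex of `U`. -/
theorem not_both_missed_of_maximal {w : V → V → ℕ} (hw : ∀ u v, w u v = w v u)
    (hw0 : ∀ v, w v v = 0) {U : Finset V}
    (hU : ∀ u ∈ U, ∀ v, 0 < w u v → v ∈ U)
    (hconn : ∀ u ∈ U, ∀ v ∈ U, (supportGraph w hw).Reachable u v)
    (hmiss : ∀ t ∈ U, ∃ N, Involutive N ∧ (∀ v, N v ≠ v → 0 < w v (N v)) ∧ N t = t ∧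
      ∀ m, Involutive m → weight w m ≤ weight w N) (n : ℕ) :
    ∀ d : ℕ, ∀ m, Involutive m → (∀ v, m v ≠ v → 0 < w v (m v)) →
      (∀ m', Involutive m' → (∀ v, m' v ≠ v → 0 < w v (m' v)) →
        (n + 1) * weight w m' - n * #(covered U m') ≤ (n + 1) * weight w m - n * #(covered U m)) →
      ∀ u ∈ U, ∀ v ∈ U, u ≠ v → m u = u → m v = v →
        (supportGraph w hw).dist u v ≤ d → False := by
  intro d
  induction d with
  | zero =>
    intro m _ _ _ u hu v hv huv _ _ hd
    exact huv ((hconn u hu v hv).dist_eq_zero_iff.mp (by omega))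
  | succ d ih =>
    intro m hm hmw hmax u hu v hv huv hmu hmv hd
    obtain ⟨p, hp⟩ := (hconn u hu v hv).exists_walk_length_eq_dist
    cases p with
    | nil => exact huv rfl
    | @cons _ t _ h q =>
      have htU : t ∈ U := hU u hu t h.2
      have hdt : (supportGraph w hw).dist t v ≤ d := by
        have := SimpleGraph.dist_le q
        rw [SimpleGraph.Walk.length_cons] at hp
        omega
      by_cases hmt : m t = t
      · exact not_pos_of_missed_of_maximal hw hw0 hm hmw hmax hmu hmt h.2
      · obtain ⟨N, hN, hNw, hNt, hNmax⟩ := hmiss t htU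
        obtain ⟨m', hm', hmw', hmt', huv', hwt, hcov⟩ :=
          exists_swapped_matching hU hm hN hmw hNw hNmax htU hNt huv hmu hmv
        have hge : (n + 1) * weight w m - n * #(covered U m) ≤
            (n + 1) * weight w m' - n * #(covered U m') := by
          have h1 : (n : ℤ) * #(covered U m') ≤ n * #(covered U m) := by
            gcongr
          have h2 : ((n : ℤ) + 1) * weight w m ≤ (n + 1) * weight w m' := by
            gcongr
          linarith
        have hmax' := fun f hf hfw => (hmax f hf hfw).trans hge
        rcases huv' with hu' | hv'
        · exact not_pos_of_missed_of_maximal hw hw0 hm' hmw' hmax' hu' hmt' h.2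
        · refine ih m' hm' hmw' hmax' t htU v hv ?_ hmt' hv' hdt
          rintro rfl
          exact hmt hmv

theorem weight_lowerOn_le {w : V → V → ℕ} (hw : ∀ u v, w u v = w v u)
    (hw0 : ∀ v, w v v = 0) {U : Finset V} (hU : ∀ u ∈ U, ∀ v, 0 < w u v → v ∈ U)
    (hconn : ∀ u ∈ U, ∀ v ∈ U, (supportGraph w hw).Reachable u v) {ν : ℤ}
    (hν : ∀ m, Involutive m → weight w m ≤ ν)
    (hmiss : ∀ t ∈ U, ∃ N, Involutive N ∧ weight w N = ν ∧ w t (N t) = 0)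
    {m : V → V} (hm : Involutive m) :
    weight (lowerOn U w) m ≤ ν - 2 * (#U / 2 : ℕ) := by
  classical
  have hl0 : ∀ v, lowerOn U w v v = 0 := by simp [lowerOn, hw0]
  have hprune {f : V → V} (hf : Involutive f) : Involutive (prune w f) := prune_involutive hw hf
  have hle : weight (lowerOn U w) m ≤ weight (lowerOn U w) (prune w m) := by
    refine Finset.sum_le_sum fun v _ => ?_
    by_cases h : w v (m v) = 0
    · simp only [prune, h, lowerOn, if_true]
      split_ifs <;> simp
    · simp [prune, h]
  refine hle.trans ?_
  rw [weight_lowerOn hU hw0 fun v => pos_of_prune_ne]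
  set n := #U with hn
  set g : (V → V) → ℤ := fun m => (n + 1) * weight w m - n * #(covered U m) with hg
  obtain ⟨M, hM, hMmax⟩ := Finset.exists_max_image
    (Finset.univ.filter fun f : V → V => Involutive f ∧ ∀ v, f v ≠ v → 0 < w v (f v)) g
    ⟨id, Finset.mem_filter.mpr ⟨Finset.mem_univ _, fun _ => rfl, fun v h => absurd rfl h⟩⟩
  simp only [Finset.mem_filter, Finset.mem_univ, true_and] at hM hMmax
  have hmissed : #{v ∈ U | M v = v} ≤ 1 := by
    rw [Finset.card_le_one]
    intro u hu v hv
    rw [Finset.mem_filter] at hu hv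
    by_contra huv
    refine not_both_missed_of_maximal hw hw0 hU hconn ?_ n _ M hM.1 hM.2
      (fun f hf hfw => hMmax f ⟨hf, hfw⟩) u hu.1 v hv.1 huv hu.2 hv.2 le_rfl
    intro t ht
    obtain ⟨N, hN, hNν, hNt⟩ := hmiss t ht
    refine ⟨prune w N, hprune hN, fun v => pos_of_prune_ne, by simp [prune, hNt], fun f hf => ?_⟩
    rw [weight_prune hw0, hNν]
    exact hν f hf
  have hcov : #{v ∈ U | M v = v} + #(covered U M) = n :=
    Finset.card_filter_add_card_filter_not (s := U) (fun v => M v = v)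
  have h1 := hMmax (prune w m) ⟨hprune hm, fun v => pos_of_prune_ne⟩
  have h2 := hν M hM.1
  simp only [hg] at h1
  set c := #(covered U (prune w m))
  set W := weight w (prune w m)
  set k := n / 2
  have heven : Even #(covered U M) := by
    refine even_card_of_involution hM.1 fun x hx => ?_
    simp only [covered, Finset.mem_filter] at hx ⊢
    exact ⟨⟨hU x hx.1 _ (hM.2 x hx.2), by rw [hM.1 x]; exact hx.2.symm⟩, hx.2⟩
  have h3 : 2 * k ≤ #(covered U M) := by
    obtain ⟨j, hj⟩ := heven
    omega
  have h4 : ((n : ℤ) + 1) * weight w M ≤ (n + 1) * ν := by gcongr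
  have h5 : (n : ℤ) * (2 * k) ≤ n * #(covered U M) := by gcongr; exact_mod_cast h3
  have h6 : 2 * k ≤ n := by omega
  by_contra! hcon
  have h7 : ((n : ℤ) + 1) * (ν - 2 * k + 1) ≤ (n + 1) * (W - c) := by
    gcongr
    omega
  have h8 : (0 : ℤ) ≤ c := by positivity
  zify at h6
  linarith

theorem even_weight {w : V → V → ℕ} (hw : ∀ u v, w u v = w v u) (hw0 : ∀ v, w v v = 0)
    {m : V → V} (hm : Involutive m) : Even (weight w m) := by
  have h : ∑ v, (w v (m v) : ZMod 2) = 0 := by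
    refine Finset.sum_involution (fun x _ => m x) (fun x _ => ?_) (fun x _ hx h => hx ?_)
      (fun _ _ => Finset.mem_univ _) (fun x _ => hm x)
    · rw [hm x, hw (m x) x]
      exact CharTwo.add_self_eq_zero _
    · rw [h, hw0, Nat.cast_zero]
  rw [weight, ← ZMod.intCast_eq_zero_iff_even]
  simpa using h

theorem exists_max_weight (w : V → V → ℕ) :
    ∃ m, Involutive m ∧ ∀ m', Involutive m' → weight w m' ≤ weight w m := by
  classical
  obtain ⟨m, hm, hmax⟩ := Finset.exists_max_image
    (Finset.univ.filter fun f : V → V => Involutive f) (weight w)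
    ⟨id, Finset.mem_filter.mpr ⟨Finset.mem_univ _, fun _ => rfl⟩⟩
  exact ⟨m, by simpa using hm, fun m' hm' => hmax m' (by simpa using hm')⟩

/-- The number of sets of `ms` (with multiplicity) whose cuts separate `u` from `v`. -/
def sepSum (ms : Multiset (Finset V)) (u v : V) : ℤ := (ms.map fun S => sep S u v).sum

@[simp]
theorem sepSum_zero (u v : V) : sepSum 0 u v = 0 := rfl

@[simp]
theorem sepSum_cons (S : Finset V) (ms : Multiset (Finset V)) (u v : V) :
    sepSum (S ::ₘ ms) u v = sep S u v + sepSum ms u v := by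
  simp [sepSum]

/-- The **Cunningham–Marsh theorem**: a weighted matching problem with integral weights has an
optimal dual solution which is half-integral on the vertices and integral on odd sets. -/
theorem exists_matching_dual (N : ℕ) : ∀ w : V → V → ℕ, (∀ u v, w u v = w v u) →
    (∀ v, w v v = 0) → ∑ u, ∑ v, w u v ≤ N →
    ∃ (m : V → V) (π : V → ℤ) (ms : Multiset (Finset V)), Involutive m ∧ (∀ S ∈ ms, Odd #S) ∧
      (∀ u v, u ≠ v → 2 * (w u v : ℤ) + sepSum ms u v ≤ π u + π v) ∧
      ∑ v, π v - ms.card ≤ weight w m := by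
  classical
  induction N using Nat.strong_induction_on with
  | _ N ih =>
  intro w hw hw0 hN
  obtain ⟨m, hm, hmax⟩ := exists_max_weight w
  by_cases hz : ∀ u v, w u v = 0
  · exact ⟨m, 0, 0, hm, by simp, by simp [hz], by simp [weight, hz]⟩
  have hlt {w' : V → V → ℕ} (hle : ∀ u v, w' u v ≤ w u v) {a b : V} (hab : w' a b < w a b) :
      ∑ u, ∑ v, w' u v < N :=
    (Finset.sum_lt_sum (fun u _ => Finset.sum_le_sum fun v _ => hle u v)
      ⟨a, Finset.mem_univ _, Finset.sum_lt_sum (fun v _ => hle a v)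
        ⟨b, Finset.mem_univ _, hab⟩⟩).trans_le hN
  by_cases hess : ∃ v, ∀ m', Involutive m' → weight w m' = weight w m → 0 < w v (m' v)
  · obtain ⟨v, hv⟩ := hess
    set w' : V → V → ℕ := fun a b => if a = v ∨ b = v then w a b - 1 else w a b with hw'def
    have hw'le : ∀ a b, w' a b ≤ w a b := by
      intro a b
      simp only [hw'def]
      split_ifs <;> omega
    have hw' : ∀ a b, w' a b = w' b a := fun a b => by simp only [hw'def, hw a b, or_comm]
    have hw'0 : ∀ a, w' a a = 0 := fun a => Nat.le_zero.mp ((hw'le a a).trans_eq (hw0 a))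
    have hpos := hv m hm rfl
    obtain ⟨m', π, ms, hm', hodd, hdual, hval⟩ := ih _
      (hlt hw'le (a := v) (b := m v) (by simp only [hw'def, true_or, if_true]; omega))
      w' hw' hw'0 le_rfl
    refine ⟨m, fun x => π x + if x = v then 2 else 0, ms, hm, hodd, fun a b hab => ?_, ?_⟩
    · have h := hdual a b hab
      simp only [hw'def] at h
      split_ifs at h ⊢ <;> first | omega | grind
    · have h1 : weight w' m' ≤ weight w m' :=
        Finset.sum_le_sum fun x _ => by exact_mod_cast hw'le x (m' x)
      have h2 : weight w' m' < weight w m := by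
        rcases (hmax m' hm').lt_or_eq with h | h
        · omega
        · have hp := hv m' hm' h
          rw [← h]
          refine Finset.sum_lt_sum (fun x _ => by exact_mod_cast hw'le x (m' x))
            ⟨v, Finset.mem_univ _, ?_⟩
          simp only [hw'def, true_or, if_true]
          omega
      obtain ⟨i, hi⟩ := even_weight hw hw0 hm
      obtain ⟨j, hj⟩ := even_weight hw' hw'0 hm'
      rw [Finset.sum_add_distrib, Finset.sum_ite_eq' Finset.univ v, if_pos (Finset.mem_univ v)]
      omega
  · push Not at hess hz
    obtain ⟨a, b, hab⟩ := hz
    have habne : a ≠ b := by rintro rfl; exact hab (hw0 a)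
    set U : Finset V := {v | (supportGraph w hw).Reachable a v} with hUdef
    have haU : a ∈ U := by simp [hUdef]
    have hU : ∀ u ∈ U, ∀ v, 0 < w u v → v ∈ U := by
      intro u hu v huv
      simp only [hUdef, Finset.mem_filter, Finset.mem_univ, true_and] at hu ⊢
      refine hu.trans (SimpleGraph.Adj.reachable ⟨?_, huv⟩)
      rintro rfl
      simp [hw0] at huv
    have hbU : b ∈ U := hU a haU b (Nat.pos_of_ne_zero hab)
    have hconn : ∀ u ∈ U, ∀ v ∈ U, (supportGraph w hw).Reachable u v := by
      intro u hu v hv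
      simp only [hUdef, Finset.mem_filter, Finset.mem_univ, true_and] at hu hv
      exact hu.symm.trans hv
    have hle : ∀ u v, lowerOn U w u v ≤ w u v := by
      intro u v
      simp only [lowerOn]
      split_ifs <;> omega
    obtain ⟨m', π, ms, hm', hodd, hdual, hval⟩ := ih _
      (hlt hle (a := a) (b := b) (by simp only [lowerOn, haU, hbU, and_self, if_true]; omega))
      (lowerOn U w) (fun u v => by simp only [lowerOn, hw u v, and_comm])
      (fun v => Nat.le_zero.mp ((hle v v).trans_eq (hw0 v))) le_rfl
    have hbound := weight_lowerOn_le hw hw0 hU hconn hmax (fun t _ => by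
      obtain ⟨N, hN, hNw, hNt⟩ := hess t
      exact ⟨N, hN, hNw, by omega⟩) hm'
    have hsum : ∑ v, (π v + if v ∈ U then 1 else 0) = ∑ v, π v + #U := by
      simp [Finset.sum_add_distrib]
    have hkey : ∀ u v, u ≠ v → 2 * (w u v : ℤ) + sep U u v + sepSum ms u v ≤
        (π u + if u ∈ U then 1 else 0) + (π v + if v ∈ U then 1 else 0) := by
      intro u v huv
      have h := hdual u v huv
      simp only [lowerOn] at h
      have h1 : u ∈ U → v ∉ U → w u v = 0 := fun hu hv => by
        by_contra h
        exact hv (hU u hu v (Nat.pos_of_ne_zero h))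
      have h2 : v ∈ U → u ∉ U → w u v = 0 := fun hv hu => by
        by_contra h
        exact hu (hU v hv u (hw u v ▸ Nat.pos_of_ne_zero h))
      clear_value U
      clear hval hbound hdual hconn hle hU hlt ih hess
      by_cases hu : u ∈ U <;> by_cases hv : v ∈ U <;>
        simp only [hu, hv, sep, and_self, and_true, and_false, if_true, if_false, iff_true,
          iff_false, not_true, not_false_eq_true, forall_const] at h h1 h2 ⊢ <;>
        omega
    have hsep : ∀ u v, 0 ≤ sep U u v := fun u v => by
      simp only [sep]
      split_ifs <;> simp
    rcases Nat.even_or_odd #U with hUe | hUo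
    · refine ⟨m, fun v => π v + if v ∈ U then 1 else 0, ms, hm, hodd, fun u v huv => ?_, ?_⟩
      · have := hkey u v huv
        have := hsep u v
        dsimp only
        omega
      · rw [hsum]
        obtain ⟨j, hj⟩ := hUe
        omega
    · refine ⟨m, fun v => π v + if v ∈ U then 1 else 0, U ::ₘ ms, hm, ?_, fun u v huv => ?_, ?_⟩
      · simpa using ⟨hUo, hodd⟩
      · have := hkey u v huv
        rw [sepSum_cons]
        dsimp only
        omega
      · rw [hsum, Multiset.card_cons]
        obtain ⟨j, hj⟩ := hUo
        push_cast
        omega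

/-- The involution `m` is a perfect matching of `Γ`. -/
def IsPM (Γ : SimpleGraph V) (m : V → V) : Prop := Involutive m ∧ ∀ v, Γ.Adj v (m v)

theorem IsPM.ne {Γ : SimpleGraph V} {m : V → V} (hm : IsPM Γ m) (v : V) : m v ≠ v :=
  (hm.2 v).ne'

/-- The number of edges of the matching `m` in the cut of `S`. -/
def crossing (S : Finset V) (m : V → V) : ℕ := #{x ∈ S | m x ∉ S}

theorem sum_sep {m : V → V} (hm : Involutive m) (S : Finset V) :
    ∑ v, sep S v (m v) = 2 * crossing S m := by
  have h1 : ∑ v, (if v ∈ S ∧ m v ∉ S then 1 else 0 : ℤ) = crossing S m := by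
    rw [Finset.sum_boole, crossing]
    congr 2
    ext v
    simp
  have h2 : ∑ v, (if m v ∈ S ∧ m (m v) ∉ S then 1 else 0 : ℤ) = crossing S m := by
    rw [← h1]
    exact Equiv.sum_comp hm.toPerm fun v => (if v ∈ S ∧ m v ∉ S then 1 else 0 : ℤ)
  rw [two_mul]
  nth_rewrite 1 [← h1]
  rw [← h2, ← Finset.sum_add_distrib]
  refine Finset.sum_congr rfl fun v _ => ?_
  rw [hm v]
  by_cases h : v ∈ S <;> by_cases h' : m v ∈ S <;> simp [sep, h, h']

theorem odd_crossing_iff {m : V → V} (hm : Involutive m) (hne : ∀ v, m v ≠ v) (S : Finset V) :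
    Odd (crossing S m) ↔ Odd #S := by
  have h : #{x ∈ S | m x ∈ S} + crossing S m = #S :=
    Finset.card_filter_add_card_filter_not (s := S) (fun x => m x ∈ S)
  have he : Even #{x ∈ S | m x ∈ S} := by
    refine even_card_of_involution hm fun x hx => ?_
    rw [Finset.mem_filter] at hx ⊢
    exact ⟨⟨hx.2, by rw [hm x]; exact hx.1⟩, hne x⟩
  rw [← h]
  grind

theorem crossing_compl {m : V → V} (hm : Involutive m) (S : Finset V) :
    crossing Sᶜ m = crossing S m := by
  have h : ∀ v, sep Sᶜ v (m v) = sep S v (m v) := fun v => by simp [sep, not_iff_not]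
  have h1 := sum_sep hm S
  have h2 := sum_sep hm Sᶜ
  simp only [h] at h2
  omega

/-- The cut of `S` contains exactly one edge of every perfect matching. -/
def Tight (Γ : SimpleGraph V) (S : Finset V) : Prop := ∀ m, IsPM Γ m → crossing S m = 1

theorem sum_sepSum {m : V → V} (hm : Involutive m) (ms : Multiset (Finset V)) :
    ∑ v, sepSum ms v (m v) = 2 * (ms.map fun S => (crossing S m : ℤ)).sum := by
  induction ms using Multiset.induction with
  | empty => simp
  | cons S ms ih =>
    simp only [sepSum_cons, Finset.sum_add_distrib, ih, sum_sep hm, Multiset.map_cons,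
      Multiset.sum_cons]
    ring

theorem card_le_sum_map {α : Type*} {s : Multiset α} {f : α → ℤ} (h : ∀ a ∈ s, 1 ≤ f a) :
    (s.card : ℤ) ≤ (s.map f).sum := by
  have := Multiset.card_nsmul_le_sum (s := s.map f) (a := 1) (by simpa using h)
  simpa using this

theorem eq_one_of_sum_map_le {α : Type*} {s : Multiset α} {f : α → ℤ} (h : ∀ a ∈ s, 1 ≤ f a)
    (hs : (s.map f).sum ≤ s.card) {a : α} (ha : a ∈ s) : f a = 1 := by
  obtain ⟨t, rfl⟩ := Multiset.exists_cons_of_mem ha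
  rw [Multiset.map_cons, Multiset.sum_cons, Multiset.card_cons] at hs
  have h1 := card_le_sum_map fun b hb => h b (Multiset.mem_cons_of_mem hb)
  have h2 := h a ha
  push_cast at hs
  omega

/-- If all perfect matchings have the same weight, then an optimal dual solution of the
maximum weight perfect matching problem is tight on all perfect matchings. -/
theorem exists_dual_of_weight_const {Γ : SimpleGraph V} {w : V → V → ℕ}
    (hw : ∀ u v, w u v = w v u) (hw1 : ∀ u v, w u v ≤ 1) {k : ℤ}
    (hk : ∀ m, IsPM Γ m → weight w m = k) (hex : ∃ m, IsPM Γ m) :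
    ∃ (π : V → ℤ) (ms : Multiset (Finset V)), (∀ S ∈ ms, Odd #S ∧ Tight Γ S) ∧
      (∀ u v, Γ.Adj u v → 2 * (w u v : ℤ) + sepSum ms u v ≤ π u + π v) ∧
      ∀ m, IsPM Γ m → ∀ v, 2 * (w v (m v) : ℤ) + sepSum ms v (m v) = π v + π (m v) := by
  classical
  set c := Fintype.card V with hc
  set w' : V → V → ℕ := fun u v => if Γ.Adj u v then c + w u v else 0 with hw'
  have hsum (b : ℤ) : ∑ _v : V, b = c * b := by simp [hc]
  have hk0 : 0 ≤ k := by
    obtain ⟨m, hm⟩ := hex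
    rw [← hk m hm]
    exact Finset.sum_nonneg fun v _ => by positivity
  have hpm : ∀ m, IsPM Γ m → weight w' m = c * c + k := by
    intro m hm
    rw [← hk m hm, weight, weight, ← hsum, ← Finset.sum_add_distrib]
    refine Finset.sum_congr rfl fun v _ => ?_
    simp [hw', hm.2 v]
  have hle : ∀ m, Involutive m → weight w' m ≤ c * c + k := by
    intro m hm
    by_cases h : ∀ v, Γ.Adj v (m v)
    · exact (hpm m ⟨hm, h⟩).le
    · push Not at h
      obtain ⟨a, ha⟩ := h
      have h1 : weight w' m ≤ ∑ v, ((c + 1 : ℤ) - if v = a then (c + 1 : ℤ) else 0) := by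
        refine Finset.sum_le_sum fun v _ => ?_
        have := hw1 v (m v)
        simp only [hw']
        split_ifs with h1 h2 h2 <;> simp_all
        omega
      rw [Finset.sum_sub_distrib, hsum, Finset.sum_ite_eq' Finset.univ a,
        if_pos (Finset.mem_univ a)] at h1
      linarith
  obtain ⟨m₀, π, ms, hm₀, hodd, hdual, hval⟩ := exists_matching_dual _ w'
    (fun u v => by simp only [hw', Γ.adj_comm, hw u v]) (fun v => by simp [hw']) le_rfl
  replace hval := hval.trans (hle m₀ hm₀)
  have hcr : ∀ m, IsPM Γ m → ∀ S ∈ ms, (1 : ℤ) ≤ crossing S m := by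
    intro m hm S hS
    exact_mod_cast ((odd_crossing_iff hm.1 hm.ne S).mpr (hodd S hS)).pos
  have hsl : ∀ m, IsPM Γ m → ∀ v, 2 * (w' v (m v) : ℤ) + sepSum ms v (m v) ≤ π v + π (m v) :=
    fun m hm v => hdual _ _ (hm.ne v).symm
  have hπ : ∀ m, IsPM Γ m → ∑ v, (π v + π (m v)) = 2 * ∑ v, π v := by
    intro m hm
    rw [Finset.sum_add_distrib, two_mul]
    congr 1
    exact Equiv.sum_comp hm.1.toPerm π
  have hls : ∀ m, IsPM Γ m → ∑ v, (2 * (w' v (m v) : ℤ) + sepSum ms v (m v)) =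
      2 * (c * c + k) + 2 * (ms.map fun S => (crossing S m : ℤ)).sum := by
    intro m hm
    rw [Finset.sum_add_distrib, sum_sepSum hm.1, ← Finset.mul_sum, ← hpm m hm, weight]
  refine ⟨fun v => π v - c, ms, fun S hS => ⟨hodd S hS, fun m hm => ?_⟩, fun u v huv => ?_,
    fun m hm v => ?_⟩
  · have h1 := Finset.sum_le_sum fun v (_ : v ∈ Finset.univ) => hsl m hm v
    rw [hls m hm, hπ m hm] at h1
    exact_mod_cast eq_one_of_sum_map_le (hcr m hm) (by linarith) hS
  · have h := hdual u v huv.ne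
    simp only [hw', huv, if_true] at h
    push_cast at h
    linarith
  · have h1 := card_le_sum_map (hcr m hm)
    have h2 := (Finset.sum_eq_sum_iff_of_le fun v (_ : v ∈ Finset.univ) => hsl m hm v).mp (by
      refine le_antisymm (Finset.sum_le_sum fun v _ => hsl m hm v) ?_
      rw [hls m hm, hπ m hm]
      linarith) v (Finset.mem_univ v)
    simp only [hw', hm.2 v, if_true] at h2
    push_cast at h2
    linarith

theorem sep_eq_add_of_trivial {S : Finset V} {a : V} (h : S = {a} ∨ Sᶜ = {a}) {u v : V}
    (huv : u ≠ v) : sep S u v = (if u = a then 1 else 0) + if v = a then 1 else 0 := by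
  have hmem : (u ∈ S ↔ v ∈ S) ↔ (u = a ↔ v = a) := by
    rcases h with rfl | h
    · simp
    · have h' : ∀ x, x ∈ S ↔ x ≠ a := fun x => by
        rw [← not_iff_not, ← Finset.mem_compl, h, Finset.mem_singleton, not_not]
      rw [h', h', not_iff_not]
  simp only [sep, hmem]
  by_cases hu : u = a <;> by_cases hv : v = a <;> simp_all

theorem exists_sepSum_eq_add_of_trivial {ms : Multiset (Finset V)}
    (h : ∀ S ∈ ms, ∃ a, S = {a} ∨ Sᶜ = {a}) :
    ∃ ρ : V → ℤ, ∀ u v, u ≠ v → sepSum ms u v = ρ u + ρ v := by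
  induction ms using Multiset.induction with
  | empty => exact ⟨0, by simp⟩
  | cons S ms ih =>
    obtain ⟨ρ, hρ⟩ := ih fun T hT => h T (Multiset.mem_cons_of_mem hT)
    obtain ⟨a, ha⟩ := h S (Multiset.mem_cons_self S ms)
    refine ⟨fun u => ρ u + if u = a then 1 else 0, fun u v huv => ?_⟩
    rw [sepSum_cons, sep_eq_add_of_trivial ha huv, hρ u v huv]
    ring

/-- Every nontrivial cut contains an edge. -/
def CutConnected (Γ : SimpleGraph V) : Prop :=
  ∀ T : Finset V, ∀ x ∈ T, ∀ y ∉ T, ∃ u ∈ T, ∃ v ∉ T, Γ.Adj u v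

/-- Deleting any two vertices leaves a connected graph. -/
def CutThreeConnected (Γ : SimpleGraph V) : Prop :=
  ∀ a b, a ≠ b → ∀ T : Finset V, T.Nonempty → a ∉ T → b ∉ T → (∃ z ∉ T, z ≠ a ∧ z ≠ b) →
    ∃ u ∈ T, ∃ v ∉ T, v ≠ a ∧ v ≠ b ∧ Γ.Adj u v

/-- Deleting any two vertices leaves a graph with a perfect matching. -/
def Bicritical (Γ : SimpleGraph V) : Prop :=
  ∀ x y, x ≠ y → ∃ m : V → V, Involutive m ∧ m x = y ∧ ∀ v, v ≠ x → v ≠ y → Γ.Adj v (m v)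

/-- If `p` vanishes along the edges of a connected nonbipartite graph, then `p` vanishes. -/
theorem eq_zero_of_adj_add_eq_zero {Γ : SimpleGraph V} (hconn : CutConnected Γ)
    (hbip : ¬ ∃ c : V → Bool, ∀ u v, Γ.Adj u v → c u ≠ c v) {p : V → ℤ}
    (hp : ∀ u v, Γ.Adj u v → p u + p v = 0) (x : V) : p x = 0 := by
  by_contra hx
  have hall : ∀ y, p y ≠ 0 := by
    intro y hy
    obtain ⟨u, hu, v, hv, huv⟩ := hconn {v | p v ≠ 0} x (by simpa using hx) y (by simpa using hy)
    simp only [Finset.mem_filter, Finset.mem_univ, true_and, not_not] at hu hv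
    have := hp u v huv
    omega
  refine hbip ⟨fun v => decide (0 < p v), fun u v huv => ?_⟩
  have h1 := hp u v huv
  have h2 := hall u
  by_cases hu : 0 < p u
  · have hv : ¬ 0 < p v := by omega
    simp [hu, hv]
  · have hv : 0 < p v := by omega
    simp [hu, hv]

theorem bicritical_of_tight_trivial {Γ : SimpleGraph V} (hconn : CutConnected Γ)
    (hcov : ∀ u v, Γ.Adj u v → ∃ m, IsPM Γ m ∧ m u = v)
    (hbip : ¬ ∃ c : V → Bool, ∀ u v, Γ.Adj u v → c u ≠ c v)
    (htriv : ∀ S, Odd #S → Tight Γ S → ∃ a, S = {a} ∨ Sᶜ = {a}) : Bicritical Γ := by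
  classical
  intro x y hxy
  by_contra hno
  set Γ' : SimpleGraph V := Γ ⊔ SimpleGraph.edge x y with hΓ'
  have hadj : ∀ u v, Γ'.Adj u v ↔ Γ.Adj u v ∨ (u = x ∧ v = y ∨ u = y ∧ v = x) := by
    intro u v
    rw [hΓ', SimpleGraph.sup_adj, SimpleGraph.edge_adj]
    grind
  have hmxy : ∀ m, IsPM Γ' m → m x ≠ y := by
    intro m hm h
    refine hno ⟨m, hm.1, h, fun v hvx hvy => ?_⟩
    simpa [hvx, hvy] using (hadj _ _).mp (hm.2 v)
  have hPM' : ∀ m, IsPM Γ m → IsPM Γ' m := fun m hm =>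
    ⟨hm.1, fun v => (hadj _ _).mpr (Or.inl (hm.2 v))⟩
  set w : V → V → ℕ := fun u v => if u = x ∧ v = y ∨ u = y ∧ v = x then 1 else 0 with hw
  have hwm : ∀ m, IsPM Γ' m → ∀ v, w v (m v) = 0 := by
    intro m hm v
    simp only [hw, ite_eq_right_iff, one_ne_zero, imp_false]
    rintro (⟨rfl, h⟩ | ⟨rfl, h⟩)
    · exact hmxy m hm h
    · exact hmxy m hm (by rw [← h, hm.1])
  obtain ⟨u₀, -, v₀, -, h₀⟩ := hconn {x} x (by simp) y (by simpa using hxy.symm)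
  obtain ⟨m₀, hm₀, -⟩ := hcov u₀ v₀ h₀
  obtain ⟨π, ms, hms, hle, heq⟩ := exists_dual_of_weight_const (Γ := Γ') (w := w) (k := 0)
    (fun u v => by
      simp only [hw, and_comm, or_comm])
    (fun u v => by
      simp only [hw]
      split_ifs <;> omega)
    (fun m hm => by simp [weight, hwm m hm]) ⟨m₀, hPM' m₀ hm₀⟩
  obtain ⟨ρ, hρ⟩ := exists_sepSum_eq_add_of_trivial fun S hS =>
    htriv S (hms S hS).1 fun m hm => (hms S hS).2 m (hPM' m hm)
  have hp : ∀ u v, Γ.Adj u v → (π u - ρ u) + (π v - ρ v) = 0 := by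
    intro u v huv
    obtain ⟨m, hm, rfl⟩ := hcov u v huv
    have h := heq m (hPM' m hm) u
    rw [hwm m (hPM' m hm) u, hρ _ _ huv.ne] at h
    push_cast at h
    linarith
  have h1 := eq_zero_of_adj_add_eq_zero hconn hbip (p := fun v => π v - ρ v) hp x
  have h2 := eq_zero_of_adj_add_eq_zero hconn hbip (p := fun v => π v - ρ v) hp y
  have h3 := hle x y ((hadj _ _).mpr (by simp))
  rw [hρ _ _ hxy] at h3
  simp only [hw, and_self, true_or, if_true] at h3
  push_cast at h3
  linarith

theorem cutThreeConnected_of_tight_trivial {Γ : SimpleGraph V} (hbi : Bicritical Γ)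
    (htriv : ∀ S, Odd #S → Tight Γ S → ∃ a, S = {a} ∨ Sᶜ = {a}) : CutThreeConnected Γ := by
  intro a b hab T hT haT hbT ⟨z, hzT, hza, hzb⟩
  by_contra! hno
  have hout : ∀ u ∈ T, ∀ v ∉ T, Γ.Adj u v → v = a ∨ v = b := by
    intro u hu v hv huv
    by_contra! h
    exact hno u hu v hv h.1 h.2 huv
  have hTe : Even #T := by
    obtain ⟨m, hm, hma, hadj⟩ := hbi a b hab
    refine even_card_of_involution hm fun x hx => ?_
    have hxa : x ≠ a := fun h => haT (h ▸ hx)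
    have hxb : x ≠ b := fun h => hbT (h ▸ hx)
    have hx' := hadj x hxa hxb
    refine ⟨?_, hx'.ne'⟩
    by_contra hmx
    rcases hout x hx _ hmx hx' with h | h
    · exact hxb (by rw [← hm x, h, hma])
    · exact hxa (by rw [← hm x, h, ← hma, hm])
  have hSo : Odd #(insert a T) := by
    rw [Finset.card_insert_of_notMem haT]
    exact hTe.add_one
  have ht : Tight Γ (insert a T) := by
    intro m hm
    have hodd := (odd_crossing_iff hm.1 hm.ne _).mpr hSo
    have hle : crossing (insert a T) m ≤ 2 := by
      refine (Finset.card_le_card (t := {a, m b}) fun x hx => ?_).trans Finset.card_le_two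
      simp only [Finset.mem_filter, Finset.mem_insert, not_or, Finset.mem_singleton] at hx ⊢
      obtain ⟨rfl | hxT, hxa, hmx⟩ := hx
      · exact Or.inl rfl
      · rcases hout x hxT _ hmx (hm.2 x) with h | h
        · exact absurd h hxa
        · exact Or.inr (by rw [← h, hm.1])
    obtain ⟨j, hj⟩ := hodd
    omega
  obtain ⟨t, ht'⟩ := hT
  obtain ⟨c, hc | hc⟩ := htriv _ hSo ht
  · have h1 : a ∈ ({c} : Finset V) := hc ▸ Finset.mem_insert_self a T
    have h2 : t ∈ ({c} : Finset V) := hc ▸ Finset.mem_insert_of_mem ht'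
    rw [Finset.mem_singleton] at h1 h2
    exact haT (h1.trans h2.symm ▸ ht')
  · have h1 : z ∈ ({c} : Finset V) := hc ▸ by simp [hza, hzT]
    have h2 : b ∈ ({c} : Finset V) := hc ▸ by simp [hab.symm, hbT]
    rw [Finset.mem_singleton] at h1 h2
    exact hzb (h1.trans h2.symm)

theorem Bicritical.exists_isPM {Γ : SimpleGraph V} (h : Bicritical Γ) {u v : V}
    (huv : Γ.Adj u v) : ∃ m, IsPM Γ m ∧ m u = v := by
  obtain ⟨m, hm, hmu, hadj⟩ := h u v huv.ne
  refine ⟨m, ⟨hm, fun x => ?_⟩, hmu⟩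
  by_cases hxu : x = u
  · rwa [hxu, hmu]
  · by_cases hxv : x = v
    · rw [hxv, ← hmu, hm, hmu]
      exact huv.symm
    · exact hadj x hxu hxv

theorem CutThreeConnected.cutConnected {Γ : SimpleGraph V} (h : CutThreeConnected Γ)
    (hV : 4 ≤ Fintype.card V) : CutConnected Γ := by
  intro T x hx y hy
  have hc : 1 < #({x, y}ᶜ : Finset V) := by
    have := Finset.card_le_two (a := x) (b := y)
    rw [Finset.card_compl]
    omega
  obtain ⟨a, ha, b, hb, hab⟩ := Finset.one_lt_card.mp hc
  simp only [Finset.mem_compl, Finset.mem_insert, Finset.mem_singleton, not_or] at ha hb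
  obtain ⟨u, hu, v, hv, hva, hvb, huv⟩ := h a b hab (T \ {a, b})
    ⟨x, by simp [hx, Ne.symm ha.1, Ne.symm hb.1]⟩ (by simp) (by simp)
    ⟨y, by simp [hy], Ne.symm ha.2, Ne.symm hb.2⟩
  simp only [Finset.mem_sdiff, Finset.mem_insert, Finset.mem_singleton, hva, hvb, or_self,
    not_false_eq_true, and_true] at hu hv
  exact ⟨u, hu.1, v, hv, huv⟩

/-- In a bicritical graph, every set `P` such that `Γ - P` has at least `#P` odd components
has at most one element. -/
theorem Bicritical.card_barrier_le_one {Γ : SimpleGraph V} (h : Bicritical Γ) {P : Finset V}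
    {ℬ : Finset (Finset V)} (hdisj : ∀ A ∈ ℬ, ∀ B ∈ ℬ, A ≠ B → Disjoint A B)
    (hodd : ∀ B ∈ ℬ, Odd #B) (hP : ∀ B ∈ ℬ, Disjoint B P)
    (hout : ∀ B ∈ ℬ, ∀ u ∈ B, ∀ v ∉ B, Γ.Adj u v → v ∈ P) (hle : #P ≤ #ℬ) : #P ≤ 1 := by
  by_contra! hlt
  obtain ⟨p, hp, q, hq, hpq⟩ := Finset.one_lt_card.mp hlt
  obtain ⟨m, hm, hmp, hadj⟩ := h p q hpq
  have hmq : m q = p := by rw [← hmp, hm]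
  have hx : ∀ B ∈ ℬ, ∃ x ∈ B, m x ∈ (P.erase p).erase q := by
    intro B hB
    have hBp : ∀ x ∈ B, x ≠ p ∧ x ≠ q := fun x hx =>
      ⟨fun h => Finset.disjoint_left.mp (hP B hB) hx (h ▸ hp),
        fun h => Finset.disjoint_left.mp (hP B hB) hx (h ▸ hq)⟩
    have : ∃ x ∈ B, m x ∉ B := by
      by_contra! hno
      refine Nat.not_even_iff_odd.mpr (hodd B hB) (even_card_of_involution hm fun x hx => ?_)
      exact ⟨hno x hx, (hadj x (hBp x hx).1 (hBp x hx).2).ne'⟩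
    obtain ⟨x, hx, hmx⟩ := this
    refine ⟨x, hx, ?_⟩
    simp only [Finset.mem_erase]
    refine ⟨fun h => (hBp x hx).1 ?_, fun h => (hBp x hx).2 ?_,
      hout B hB x hx _ hmx (hadj x (hBp x hx).1 (hBp x hx).2)⟩
    · rw [← hm x, h, hmq]
    · rw [← hm x, h, hmp]
  have : Nonempty V := ⟨p⟩
  choose! f hfB hfP using hx
  have hcard := Finset.card_le_card_of_injOn (fun B => m (f B)) hfP (by
    intro A hA B hB hAB
    by_contra hne
    refine Finset.disjoint_left.mp (hdisj A hA B hB hne) (hfB A hA) ?_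
    rw [hm.injective hAB]
    exact hfB B hB)
  rw [Finset.card_erase_of_mem (by simp [hq, hpq.symm]), Finset.card_erase_of_mem hp] at hcard
  omega

/-- The graph induced by `S` is, after shrinking each member of `ℬ` to a vertex, bipartite with
colour classes `P` and `ℬ`. -/
structure IsBlobBipartition (Γ : SimpleGraph V) (S P : Finset V) (ℬ : Finset (Finset V)) :
    Prop where
  subset : P ⊆ S
  blob_subset : ∀ B ∈ ℬ, B ⊆ S
  disjoint : ∀ A ∈ ℬ, ∀ B ∈ ℬ, A ≠ B → Disjoint A B
  blob_disjoint : ∀ B ∈ ℬ, Disjoint B P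
  odd : ∀ B ∈ ℬ, Odd #B
  tight : ∀ B ∈ ℬ, Tight Γ B
  cover : ∀ x ∈ S, x ∉ P → ∃ B ∈ ℬ, x ∈ B
  not_adj : ∀ u ∈ P, ∀ v ∈ P, ¬ Γ.Adj u v
  mem_of_adj : ∀ B ∈ ℬ, ∀ u ∈ B, ∀ v ∈ S, v ∉ B → Γ.Adj u v → v ∈ P

namespace IsBlobBipartition

variable {Γ : SimpleGraph V} {S P : Finset V} {ℬ : Finset (Finset V)}

theorem card_add_card (h : IsBlobBipartition Γ S P ℬ) {m : V → V} (hm : IsPM Γ m) :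
    #ℬ + #{x ∈ P | m x ∉ S} = #P + #{x ∈ S \ P | m x ∉ S} := by
  have h1 : ∑ B ∈ ℬ, #{x ∈ B | m x ∉ B} = #ℬ := by
    rw [Finset.card_eq_sum_ones]
    exact Finset.sum_congr rfl fun B hB => h.tight B hB m hm
  have h2 : ∑ B ∈ ℬ, #{x ∈ B | m x ∉ B} = #{x ∈ S \ P | m x ∈ P} + #{x ∈ S \ P | m x ∉ S} := by
    have hU : S \ P = ℬ.biUnion id := by
      ext x
      simp only [Finset.mem_sdiff, Finset.mem_biUnion, id]
      constructor
      · rintro ⟨hxS, hxP⟩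
        exact h.cover x hxS hxP
      · rintro ⟨B, hB, hx⟩
        exact ⟨h.blob_subset B hB hx, Finset.disjoint_left.mp (h.blob_disjoint B hB) hx⟩
    rw [hU, Finset.filter_biUnion, Finset.filter_biUnion, Finset.card_biUnion, Finset.card_biUnion,
      ← Finset.sum_add_distrib]
    · refine Finset.sum_congr rfl fun B hB => ?_
      rw [id, ← Finset.card_union_of_disjoint]
      · congr 1
        ext x
        simp only [Finset.mem_filter, Finset.mem_union]
        constructor
        · rintro ⟨hx, hmx⟩
          by_cases hS : m x ∈ S
          · exact Or.inl ⟨hx, h.mem_of_adj B hB x hx _ hS hmx (hm.2 x)⟩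
          · exact Or.inr ⟨hx, hS⟩
        · rintro (⟨hx, hmx⟩ | ⟨hx, hmx⟩)
          · exact ⟨hx, fun h' => Finset.disjoint_left.mp (h.blob_disjoint B hB) h' hmx⟩
          · exact ⟨hx, fun h' => hmx (h.blob_subset B hB h')⟩
      · rw [Finset.disjoint_left]
        intro x hx hx'
        simp only [Finset.mem_filter] at hx hx'
        exact hx'.2 (h.subset hx.2)
    all_goals
      intro A hA B hB hAB
      exact Finset.disjoint_filter_filter (h.disjoint A hA B hB hAB)
  have h3 : #{x ∈ S \ P | m x ∈ P} = #{x ∈ P | m x ∈ S} := by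
    refine Finset.card_bij' (fun x _ => m x) (fun x _ => m x) ?_ ?_ (fun x _ => hm.1 x)
      fun x _ => hm.1 x
    · intro x hx
      simp only [Finset.mem_filter, Finset.mem_sdiff] at hx ⊢
      exact ⟨hx.2, by rw [hm.1 x]; exact hx.1.1⟩
    · intro x hx
      simp only [Finset.mem_filter, Finset.mem_sdiff] at hx ⊢
      exact ⟨⟨hx.2, fun h' => h.not_adj x hx.1 _ h' (hm.2 x)⟩, by rw [hm.1 x]; exact hx.1⟩
  have h4 : #{x ∈ P | m x ∈ S} + #{x ∈ P | m x ∉ S} = #P :=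
    Finset.card_filter_add_card_filter_not (s := P) (fun x => m x ∈ S)
  omega

theorem crossing_eq (h : IsBlobBipartition Γ S P ℬ) (m : V → V) :
    crossing S m = #{x ∈ P | m x ∉ S} + #{x ∈ S \ P | m x ∉ S} := by
  rw [← Finset.card_union_of_disjoint, ← Finset.filter_union, Finset.union_sdiff_of_subset h.subset]
  · rfl
  · exact Finset.disjoint_filter_filter Finset.disjoint_sdiff

theorem card_eq_of_univ (h : IsBlobBipartition Γ univ P ℬ) {m : V → V} (hm : IsPM Γ m) :
    #ℬ = #P := by
  simpa using h.card_add_card hm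

theorem card_eq_and_not_adj (hbi : Bicritical Γ) (h : IsBlobBipartition Γ S P ℬ)
    (hpm : ∃ m, IsPM Γ m) (hS : Tight Γ S) (hSc : Odd #Sᶜ) (hcard : 2 ≤ #S) :
    #ℬ = #P + 1 ∧ ∀ p ∈ P, ∀ v ∉ S, ¬ Γ.Adj p v := by
  have key : ∀ m, IsPM Γ m → #ℬ + #{x ∈ P | m x ∉ S} = #P + #{x ∈ S \ P | m x ∉ S} ∧
      #{x ∈ P | m x ∉ S} + #{x ∈ S \ P | m x ∉ S} = 1 := fun m hm =>
    ⟨h.card_add_card hm, by rw [← h.crossing_eq m, hS m hm]⟩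
  obtain ⟨m₀, hm₀⟩ := hpm
  have k₀ := key m₀ hm₀
  by_cases hc : #{x ∈ P | m₀ x ∉ S} = 0
  · refine ⟨by omega, fun p hp v hv hpv => ?_⟩
    obtain ⟨m, hm, hmp⟩ := hbi.exists_isPM hpv
    have k := key m hm
    have : 0 < #{x ∈ P | m x ∉ S} := Finset.card_pos.mpr ⟨p, by simp [hp, hmp, hv]⟩
    omega
  · exfalso
    have hN : ∀ u ∈ S, u ∉ P → ∀ v ∉ S, ¬ Γ.Adj u v := by
      intro u hu huP v hv huv
      obtain ⟨m, hm, hmu⟩ := hbi.exists_isPM huv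
      have k := key m hm
      have : 0 < #{x ∈ S \ P | m x ∉ S} := Finset.card_pos.mpr ⟨u, by simp [hu, huP, hmu, hv]⟩
      omega
    have hBS : ∀ B ∈ ℬ, Disjoint B Sᶜ := fun B hB =>
      (disjoint_compl_right (a := S)).mono_left (h.blob_subset B hB)
    have hnot : Sᶜ ∉ ℬ := fun hmem => by
      obtain ⟨x, hx⟩ := Finset.card_pos.mp hSc.pos
      exact Finset.disjoint_left.mp (hBS _ hmem) hx hx
    have hP1 : #P ≤ 1 := by
      refine hbi.card_barrier_le_one (ℬ := insert Sᶜ ℬ) ?_ ?_ ?_ ?_ ?_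
      · intro A hA B hB hAB
        rw [Finset.mem_insert] at hA hB
        rcases hA with rfl | hA <;> rcases hB with rfl | hB
        · exact absurd rfl hAB
        · exact (hBS B hB).symm
        · exact hBS A hA
        · exact h.disjoint A hA B hB hAB
      · simpa using ⟨hSc, h.odd⟩
      · simpa using ⟨(disjoint_compl_right (a := S)).symm.mono_right h.subset,
          h.blob_disjoint⟩
      · intro B hB u hu v hv huv
        rcases Finset.mem_insert.mp hB with rfl | hB
        · simp only [Finset.mem_compl, not_not] at hu hv
          by_contra hvP
          exact hN v hv hvP u hu huv.symm
        · have huS := h.blob_subset B hB hu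
          have huP := Finset.disjoint_left.mp (h.blob_disjoint B hB) hu
          refine h.mem_of_adj B hB u hu v ?_ hv huv
          by_contra hvS
          exact hN u huS huP v hvS huv
      · rw [Finset.card_insert_of_notMem hnot]
        omega
    have hℬ : ℬ = ∅ := Finset.card_eq_zero.mp (by omega)
    have hSP : S ⊆ P := by
      intro x hx
      by_contra hxP
      obtain ⟨B, hB, -⟩ := h.cover x hx hxP
      simp [hℬ] at hB
    have := Finset.card_le_card hSP
    omega

end IsBlobBipartition

theorem exists_adj_of_ssubset {Γ : SimpleGraph V} (hbi : Bicritical Γ) (hconn : CutConnected Γ)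
    {S T : Finset V} (hS : S = univ ∨ Odd #S ∧ Tight Γ S) (hT : T.Nonempty) (hTS : T ⊂ S) :
    ∃ u ∈ T, ∃ v ∈ S, v ∉ T ∧ Γ.Adj u v := by
  obtain ⟨x, hx⟩ := hT
  obtain ⟨y, hyS, hyT⟩ := Finset.exists_of_ssubset hTS
  rcases hS with rfl | ⟨hodd, htight⟩
  · obtain ⟨u, hu, v, hv, huv⟩ := hconn T x hx y hyT
    exact ⟨u, hu, v, Finset.mem_univ v, hv, huv⟩
  · by_contra! hno
    have key : ∀ A B : Finset V, A ∪ B = S → Disjoint A B → (∀ u ∈ A, ∀ v ∈ B, ¬ Γ.Adj u v) →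
        Even #A → A.Nonempty → B.Nonempty → False := by
      rintro A B rfl hAB hno hA ⟨a, ha⟩ ⟨b, hb⟩
      obtain ⟨u, hu, v, hv, huv⟩ := hconn A a ha b (Finset.disjoint_right.mp hAB hb)
      have hvB : v ∉ B := fun hvB => hno u hu v hvB huv
      obtain ⟨m, hm, hmu⟩ := hbi.exists_isPM huv
      have h1 := htight m hm
      have h2 : crossing A m + crossing B m = crossing (A ∪ B) m := by
        rw [crossing, crossing, crossing, ← Finset.card_union_of_disjoint
          (Finset.disjoint_filter_filter hAB)]
        congr 1
        ext z
        simp only [Finset.mem_union, Finset.mem_filter, not_or]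
        have hz := hm.2 z
        have e1 : z ∈ A → m z ∉ B := fun h h' => hno _ h _ h' hz
        have e2 : z ∈ B → m z ∉ A := fun h h' => hno _ h' _ h hz.symm
        tauto
      have h3 : 0 < crossing A m := Finset.card_pos.mpr ⟨u, by simp [hu, hmu, hv]⟩
      have h4 : ¬ Odd (crossing A m) := by
        rw [odd_crossing_iff hm.1 hm.ne, Nat.not_odd_iff_even]
        exact hA
      have h5 : crossing A m = 1 := by omega
      exact h4 (h5 ▸ odd_one)
    have hcard := Finset.card_sdiff_add_card_eq_card hTS.subset
    rcases Nat.even_or_odd #T with he | ho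
    · exact key T (S \ T) (Finset.union_sdiff_of_subset hTS.subset) Finset.disjoint_sdiff
        (fun u hu v hv => hno u hu v (Finset.mem_sdiff.mp hv).1 (Finset.mem_sdiff.mp hv).2) he
        ⟨x, hx⟩ ⟨y, by simp [hyS, hyT]⟩
    · refine key (S \ T) T (Finset.sdiff_union_of_subset hTS.subset) Finset.sdiff_disjoint
        (fun u hu v hv huv => hno v hv u (Finset.mem_sdiff.mp hu).1 (Finset.mem_sdiff.mp hu).2
          huv.symm) ?_ ⟨y, by simp [hyS, hyT]⟩ ⟨x, hx⟩
      obtain ⟨i, hi⟩ := ho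
      obtain ⟨j, hj⟩ := hodd
      exact ⟨j - i, by omega⟩

theorem sep_compl (S : Finset V) (u v : V) : sep Sᶜ u v = sep S u v := by
  simp [sep, not_iff_not]

theorem sep_nonneg (S : Finset V) (u v : V) : 0 ≤ sep S u v := by
  simp only [sep]
  split_ifs <;> simp

theorem sepSum_nonneg (ms : Multiset (Finset V)) (u v : V) : 0 ≤ sepSum ms u v :=
  Multiset.sum_nonneg fun x hx => by
    obtain ⟨S, -, rfl⟩ := Multiset.mem_map.mp hx
    exact sep_nonneg S u v

theorem sep_add_sep (S T : Finset V) (u v : V) :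
    sep S u v + sep T u v = sep (S ∩ T) u v + sep (S ∪ T) u v +
      2 * if (u ∈ S \ T ∧ v ∈ T \ S) ∨ (v ∈ S \ T ∧ u ∈ T \ S) then 1 else 0 := by
  by_cases h1 : u ∈ S <;> by_cases h2 : u ∈ T <;> by_cases h3 : v ∈ S <;> by_cases h4 : v ∈ T <;>
    simp [sep, h1, h2, h3, h4]

theorem Tight.compl {Γ : SimpleGraph V} {S : Finset V} (h : Tight Γ S) : Tight Γ Sᶜ :=
  fun m hm => (crossing_compl hm.1 S).trans (h m hm)

theorem odd_card_compl (hV : Even (Fintype.card V)) {S : Finset V} (h : Odd #S) : Odd #Sᶜ := by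
  have := Finset.card_add_card_compl S
  grind

theorem tight_uncross {Γ : SimpleGraph V} {S T : Finset V} (hS : Tight Γ S) (hT : Tight Γ T)
    (hSo : Odd #S) (hTo : Odd #T) (hST : Odd #(S ∩ T)) {m : V → V} (hm : IsPM Γ m) :
    crossing (S ∩ T) m = 1 ∧ crossing (S ∪ T) m = 1 ∧
      ∀ v, ¬ ((v ∈ S \ T ∧ m v ∈ T \ S) ∨ (m v ∈ S \ T ∧ v ∈ T \ S)) := by
  have hUo : Odd #(S ∪ T) := by
    have := Finset.card_union_add_card_inter S T
    grind
  have h := Finset.sum_congr (rfl : (univ : Finset V) = univ) fun v _ => sep_add_sep S T v (m v)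
  rw [Finset.sum_add_distrib, Finset.sum_add_distrib, Finset.sum_add_distrib, sum_sep hm.1,
    sum_sep hm.1, sum_sep hm.1, sum_sep hm.1, hS m hm, hT m hm, ← Finset.mul_sum,
    Finset.sum_boole] at h
  have h1 := ((odd_crossing_iff hm.1 hm.ne _).mpr hST).pos
  have h2 := ((odd_crossing_iff hm.1 hm.ne _).mpr hUo).pos
  refine ⟨by omega, by omega, fun v hv => ?_⟩
  have h3 : #{v | (v ∈ S \ T ∧ m v ∈ T \ S) ∨ (m v ∈ S \ T ∧ v ∈ T \ S)} = 0 := by omega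
  rw [Finset.card_eq_zero] at h3
  exact Finset.notMem_empty v (h3 ▸ Finset.mem_filter.mpr ⟨Finset.mem_univ v, hv⟩)

/-- A nontrivial tight cut, given by an odd shore. -/
structure IsGoodCut (Γ : SimpleGraph V) (S : Finset V) : Prop where
  odd : Odd #S
  tight : Tight Γ S
  two_le : 2 ≤ #S
  two_le_compl : 2 ≤ #Sᶜ

theorem IsGoodCut.compl {Γ : SimpleGraph V} {S : Finset V} (hV : Even (Fintype.card V))
    (h : IsGoodCut Γ S) : IsGoodCut Γ Sᶜ :=
  ⟨odd_card_compl hV h.odd, h.tight.compl, h.two_le_compl, by simpa using h.two_le⟩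

theorem IsGoodCut.uncross {Γ : SimpleGraph V} (hbi : Bicritical Γ) (h3 : CutThreeConnected Γ)
    (hV : Even (Fintype.card V)) {S T : Finset V} (hS : IsGoodCut Γ S) (hT : IsGoodCut Γ T)
    (hST : Odd #(S ∩ T)) {x y : V} (hx : x ∈ S \ T) (hy : y ∈ T \ S) :
    (Odd #(S ∪ T) ∧ Tight Γ (S ∩ T) ∧ Tight Γ (S ∪ T)) ∧
      (∀ u v, Γ.Adj u v → sep S u v + sep T u v = sep (S ∩ T) u v + sep (S ∪ T) u v) ∧
      (IsGoodCut Γ (S ∩ T) ∨ IsGoodCut Γ (S ∪ T)) := by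
  have hUo : Odd #(S ∪ T) := by
    have := Finset.card_union_add_card_inter S T
    have := hS.odd
    have := hT.odd
    grind
  have key := fun m hm => tight_uncross hS.tight hT.tight hS.odd hT.odd hST (m := m) hm
  have hIt : Tight Γ (S ∩ T) := fun m hm => (key m hm).1
  have hUt : Tight Γ (S ∪ T) := fun m hm => (key m hm).2.1
  have hadj : ∀ u v, Γ.Adj u v → ¬ ((u ∈ S \ T ∧ v ∈ T \ S) ∨ (v ∈ S \ T ∧ u ∈ T \ S)) := by
    intro u v huv
    obtain ⟨m, hm, rfl⟩ := hbi.exists_isPM huv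
    exact (key m hm).2.2 u
  refine ⟨⟨hUo, hIt, hUt⟩, fun u v huv => ?_, ?_⟩
  · rw [sep_add_sep, if_neg (hadj u v huv)]
    ring
  · rw [Finset.mem_sdiff] at hx hy
    have hne : x ≠ y := fun h => hx.2 (h ▸ hy.1)
    have hIc : 2 ≤ #(S ∩ T)ᶜ := by
      rw [← Finset.card_pair hne]
      refine Finset.card_le_card fun z hz => ?_
      simp only [Finset.mem_insert, Finset.mem_singleton, Finset.mem_compl,
        Finset.mem_inter] at hz ⊢
      rcases hz with rfl | rfl
      · exact fun h => hx.2 h.2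
      · exact fun h => hy.2 h.1
    have hU2 : 2 ≤ #(S ∪ T) := hS.two_le.trans (Finset.card_le_card Finset.subset_union_left)
    by_contra! hcon
    have hI1 : #(S ∩ T) = 1 := by
      have := hST.pos
      by_contra h
      exact hcon.1 ⟨hST, hIt, by omega, hIc⟩
    have hU1 : #(S ∪ T)ᶜ = 1 := by
      have := (odd_card_compl hV hUo).pos
      by_contra h
      exact hcon.2 ⟨hUo, hUt, hU2, by omega⟩
    obtain ⟨a, ha⟩ := Finset.card_eq_one.mp hI1
    obtain ⟨b, hb⟩ := Finset.card_eq_one.mp hU1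
    have ha' : ∀ z, z ∈ S → z ∈ T → z = a := fun z h h' =>
      Finset.mem_singleton.mp (ha ▸ Finset.mem_inter.mpr ⟨h, h'⟩)
    have hb' : ∀ z, z ∉ S → z ∉ T → z = b := fun z h h' =>
      Finset.mem_singleton.mp (hb ▸ by simp [h, h'])
    have haI : a ∈ S ∩ T := ha ▸ Finset.mem_singleton_self a
    have hbU : b ∈ (S ∪ T)ᶜ := hb ▸ Finset.mem_singleton_self b
    simp only [Finset.mem_inter, Finset.mem_compl, Finset.mem_union, not_or] at haI hbU
    obtain ⟨u, hu, v, hv, hva, hvb, huv⟩ := h3 a b (fun h => hbU.1 (h ▸ haI.1)) (S \ T)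
      ⟨x, by simpa using hx⟩ (by simp [haI.2]) (by simp [hbU.1])
      ⟨y, by simp [hy.2], fun h => hy.2 (h ▸ haI.1), fun h => hbU.2 (h ▸ hy.1)⟩
    refine hadj u v huv (Or.inl ⟨hu, ?_⟩)
    simp only [Finset.mem_sdiff, not_and, not_not] at hv ⊢
    have := ha' v
    have := hb' v
    tauto

/-- The function `π` expresses a combination of cuts in terms of vertex stars. -/
def IsRelation (Γ : SimpleGraph V) (ms : Multiset (Finset V)) (π : V → ℤ) : Prop :=
  ∀ u v, Γ.Adj u v → sepSum ms u v = π u + π v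

/-- The potential function which decreases when uncrossing sets. -/
def cutPotential (ms : Multiset (Finset V)) : ℕ := (ms.map fun S => #S * #Sᶜ).sum

theorem cutPotential_cons (S : Finset V) (ms : Multiset (Finset V)) :
    cutPotential (S ::ₘ ms) = #S * #Sᶜ + cutPotential ms := by
  simp [cutPotential]

theorem exists_isRelation_normalized {Γ : SimpleGraph V} (hV : Even (Fintype.card V)) (r : V)
    (ms : Multiset (Finset V)) (hms : ∀ S ∈ ms, Odd #S ∧ Tight Γ S) :
    ∀ π, IsRelation Γ ms π → ∃ ms' π', IsRelation Γ ms' π' ∧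
      (∀ S ∈ ms', IsGoodCut Γ S ∧ r ∉ S) ∧ cutPotential ms' ≤ cutPotential ms ∧
      ((∃ S ∈ ms, IsGoodCut Γ S) → ms' ≠ 0) := by
  suffices ∃ (ms' : Multiset (Finset V)) (ρ : V → ℤ),
      (∀ u v, u ≠ v → sepSum ms u v = sepSum ms' u v + ρ u + ρ v) ∧
      (∀ S ∈ ms', IsGoodCut Γ S ∧ r ∉ S) ∧ cutPotential ms' ≤ cutPotential ms ∧
      ((∃ S ∈ ms, IsGoodCut Γ S) → ms' ≠ 0) by
    intro π hπ
    obtain ⟨ms', ρ, h1, h2⟩ := this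
    refine ⟨ms', fun v => π v - ρ v, fun u v huv => ?_, h2⟩
    have := hπ u v huv
    rw [h1 u v huv.ne] at this
    linarith
  induction ms using Multiset.induction with
  | empty => exact ⟨0, 0, by simp, by simp, le_rfl, by simp⟩
  | cons S ms ih =>
    obtain ⟨ms', ρ, h1, h2, h3, h4⟩ := ih fun T hT => hms T (Multiset.mem_cons_of_mem hT)
    have hS := hms S (Multiset.mem_cons_self S ms)
    have hSc := odd_card_compl hV hS.1
    rw [cutPotential_cons]
    by_cases hg : IsGoodCut Γ S
    · by_cases hr : r ∈ S
      · refine ⟨Sᶜ ::ₘ ms', ρ, fun u v huv => ?_, ?_, ?_, by simp⟩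
        · rw [sepSum_cons, sepSum_cons, sep_compl, h1 u v huv]
          ring
        · simpa using ⟨⟨hg.compl hV, hr⟩, h2⟩
        · rw [cutPotential_cons, compl_compl, mul_comm]
          omega
      · refine ⟨S ::ₘ ms', ρ, fun u v huv => ?_, ?_, ?_, by simp⟩
        · rw [sepSum_cons, sepSum_cons, h1 u v huv]
          ring
        · simpa using ⟨⟨hg, hr⟩, h2⟩
        · rw [cutPotential_cons]
          omega
    · have htriv : ∃ a, S = {a} ∨ Sᶜ = {a} := by
        by_cases h : #S = 1
        · obtain ⟨a, ha⟩ := Finset.card_eq_one.mp h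
          exact ⟨a, Or.inl ha⟩
        · have : #Sᶜ = 1 := by
            have := hS.1.pos
            have := hSc.pos
            by_contra h'
            exact hg ⟨hS.1, hS.2, by omega, by omega⟩
          obtain ⟨a, ha⟩ := Finset.card_eq_one.mp this
          exact ⟨a, Or.inr ha⟩
      obtain ⟨a, ha⟩ := htriv
      refine ⟨ms', fun v => ρ v + if v = a then 1 else 0, fun u v huv => ?_, h2, by omega, ?_⟩
      · rw [sepSum_cons, sep_eq_add_of_trivial ha huv, h1 u v huv]
        ring
      · rintro ⟨T, hT, hTg⟩
        rcases Multiset.mem_cons.mp hT with rfl | hT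
        · exact absurd hTg hg
        · exact h4 ⟨T, hT, hTg⟩

/-- No two members of the family cross. -/
def IsLaminar (ms : Multiset (Finset V)) : Prop :=
  ∀ S ∈ ms, ∀ T ∈ ms, Disjoint S T ∨ S ⊆ T ∨ T ⊆ S

theorem card_mul_card_compl_uncross_lt {S T : Finset V} {x y : V} (hx : x ∈ S \ T)
    (hy : y ∈ T \ S) :
    #(S ∩ T) * #(S ∩ T)ᶜ + #(S ∪ T) * #(S ∪ T)ᶜ < #S * #Sᶜ + #T * #Tᶜ := by
  have h1 := Finset.card_inter_add_card_sdiff S T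
  have h2 := Finset.card_inter_add_card_sdiff T S
  have h3 := Finset.card_union_add_card_inter S T
  have h4 := Finset.card_add_card_compl S
  have h5 := Finset.card_add_card_compl T
  have h6 := Finset.card_add_card_compl (S ∩ T)
  have h7 := Finset.card_add_card_compl (S ∪ T)
  have h8 : 0 < #(S \ T) := Finset.card_pos.mpr ⟨x, hx⟩
  have h9 : 0 < #(T \ S) := Finset.card_pos.mpr ⟨y, hy⟩
  rw [Finset.inter_comm T S] at h2
  have h10 := Nat.mul_pos h8 h9
  obtain ⟨e1, e2, e3, e4, e5⟩ : #S = #(S ∩ T) + #(S \ T) ∧ #T = #(S ∩ T) + #(T \ S) ∧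
      #(S ∪ T) = #(S ∩ T) + #(S \ T) + #(T \ S) ∧ #Sᶜ = #(T \ S) + #(S ∪ T)ᶜ ∧
      #Tᶜ = #(S \ T) + #(S ∪ T)ᶜ := by omega
  have e6 : #(S ∩ T)ᶜ = #(S \ T) + #(T \ S) + #(S ∪ T)ᶜ := by omega
  rw [e1, e2, e3, e4, e5, e6]
  nlinarith

theorem exists_isRelation_isLaminar {Γ : SimpleGraph V} (hbi : Bicritical Γ)
    (h3 : CutThreeConnected Γ) (hV : Even (Fintype.card V)) (r : V) (N : ℕ) :
    ∀ ms π, IsRelation Γ ms π → (∀ S ∈ ms, IsGoodCut Γ S ∧ r ∉ S) → ms ≠ 0 →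
      cutPotential ms ≤ N → ∃ ms' π', IsRelation Γ ms' π' ∧ (∀ S ∈ ms', IsGoodCut Γ S) ∧ ms' ≠ 0 ∧
        IsLaminar ms' := by
  induction N using Nat.strong_induction_on with
  | _ N ih =>
  intro ms π hπ hms hne hN
  by_cases hlam : IsLaminar ms
  · exact ⟨ms, π, hπ, fun S hS => (hms S hS).1, hne, hlam⟩
  simp only [IsLaminar] at hlam
  push Not at hlam
  obtain ⟨S, hS, T, hT, hdisj, hST, hTS⟩ := hlam
  obtain ⟨z, hzS, hzT⟩ := Finset.not_disjoint_iff.mp hdisj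
  obtain ⟨x, hxS, hxT⟩ := Finset.not_subset.mp hST
  obtain ⟨y, hyT, hyS⟩ := Finset.not_subset.mp hTS
  obtain ⟨ms₁, rfl⟩ := Multiset.exists_cons_of_mem hS
  have hT₁ : T ∈ ms₁ := by
    rcases Multiset.mem_cons.mp hT with rfl | h
    · exact absurd hxS hxT
    · exact h
  obtain ⟨ms₂, rfl⟩ := Multiset.exists_cons_of_mem hT₁
  have hSr := hms S hS
  have hTr := hms T hT
  have hrest : ∀ A ∈ ms₂, IsGoodCut Γ A := fun A hA =>
    (hms A (Multiset.mem_cons_of_mem (Multiset.mem_cons_of_mem hA))).1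
  rw [cutPotential_cons, cutPotential_cons] at hN
  have key : ∀ T', IsGoodCut Γ T' → (∀ u v, sep T' u v = sep T u v) →
      #T' * #T'ᶜ = #T * #Tᶜ → Odd #(S ∩ T') → ∀ x ∈ S \ T', ∀ y ∈ T' \ S,
      ∃ ms' π', IsRelation Γ ms' π' ∧ (∀ S ∈ ms', IsGoodCut Γ S) ∧ ms' ≠ 0 ∧ IsLaminar ms' := by
    intro T' hT' hsep hcard hodd x hx y hy
    obtain ⟨⟨hUo, hIt, hUt⟩, hadj, hgood⟩ := hSr.1.uncross hbi h3 hV hT' hodd hx hy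
    have hrel : IsRelation Γ ((S ∩ T') ::ₘ (S ∪ T') ::ₘ ms₂) π := by
      intro u v huv
      have h1 := hπ u v huv
      have h2 := hadj u v huv
      rw [sepSum_cons, sepSum_cons] at h1 ⊢
      rw [hsep] at h2
      linarith
    obtain ⟨ms', π', h1, h2, h3, h4⟩ := exists_isRelation_normalized hV r _ (by
      simpa using ⟨⟨hodd, hIt⟩, ⟨hUo, hUt⟩, fun A hA => ⟨(hrest A hA).odd, (hrest A hA).tight⟩⟩)
      π hrel
    refine ih _ ?_ ms' π' h1 h2 (h4 ?_) le_rfl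
    · have := card_mul_card_compl_uncross_lt hx hy
      rw [cutPotential_cons, cutPotential_cons] at h3
      omega
    · rcases hgood with h | h
      · exact ⟨_, by simp, h⟩
      · exact ⟨_, by simp, h⟩
  rcases Nat.even_or_odd #(S ∩ T) with he | ho
  · refine key Tᶜ (hTr.1.compl hV) (sep_compl T) (by rw [compl_compl, mul_comm]) ?_
      z (by simp [hzS, hzT]) r (by simp [hSr.2, hTr.2])
    have h1 := Finset.card_inter_add_card_sdiff S T
    have h2 := hSr.1.odd
    rw [← Finset.sdiff_eq_inter_compl]
    grind
  · exact key T hTr.1 (fun _ _ => rfl) rfl ho x (by simp [hxS, hxT]) y (by simp [hyS, hyT])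

theorem tight_singleton (Γ : SimpleGraph V) (a : V) : Tight Γ {a} := by
  intro m hm
  rw [crossing, Finset.filter_true_of_mem, Finset.card_singleton]
  simpa using hm.ne a

theorem sepSum_eq_zero {ms : Multiset (Finset V)} {u v : V} (h : ∀ T ∈ ms, (u ∈ T ↔ v ∈ T)) :
    sepSum ms u v = 0 :=
  Multiset.sum_eq_zero fun x hx => by
    obtain ⟨T, hT, rfl⟩ := Multiset.mem_map.mp hx
    simp [sep, h T hT]

theorem sep_le_sepSum {ms : Multiset (Finset V)} {T : Finset V} (hT : T ∈ ms) (u v : V) :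
    sep T u v ≤ sepSum ms u v := by
  obtain ⟨ms', rfl⟩ := Multiset.exists_cons_of_mem hT
  have := sepSum_nonneg ms' u v
  rw [sepSum_cons]
  omega

theorem sepSum_add (ms ms' : Multiset (Finset V)) (u v : V) :
    sepSum (ms + ms') u v = sepSum ms u v + sepSum ms' u v := by
  simp [sepSum]

/-- The sign pattern of a potential which vanishes on the blobs `Ch` and is antisymmetric along the
remaining edges gives a bipartition. -/
theorem isBlobBipartition_of_sign {Γ : SimpleGraph V} (hbi : Bicritical Γ)
    (hconn : CutConnected Γ) {π : V → ℤ} {S : Finset V} {Ch : Finset (Finset V)}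
    (hS : S = univ ∨ Odd #S ∧ Tight Γ S)
    (hCh : ∀ A ∈ Ch, A ⊆ S ∧ Odd #A ∧ Tight Γ A ∧ ∀ x ∈ A, π x = 0)
    (hdisj : ∀ A ∈ Ch, ∀ B ∈ Ch, A ≠ B → Disjoint A B)
    (hchild : ∀ A ∈ Ch, ∀ u ∈ A, ∀ v ∈ S, v ∉ A → Γ.Adj u v → 0 < π v)
    (hfree : ∀ u ∈ S, ∀ v ∈ S, (∀ A ∈ Ch, u ∉ A) → (∀ A ∈ Ch, v ∉ A) → Γ.Adj u v →
      π u + π v = 0)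
    (hex : ∃ x ∈ S, π x ≠ 0 ∨ ∃ A ∈ Ch, x ∈ A) :
    IsBlobBipartition Γ S {x ∈ S | 0 < π x} (Ch ∪ ({x ∈ S | π x < 0}).image singleton) := by
  have hnot : ∀ u, π u ≠ 0 → ∀ A ∈ Ch, u ∉ A := fun u hu A hA h =>
    hu ((hCh A hA).2.2.2 u h)
  have hcover : ∀ x ∈ S, π x = 0 → ∃ A ∈ Ch, x ∈ A := by
    by_contra! hno
    obtain ⟨x, hx, hπx, hxA⟩ := hno
    obtain ⟨y, hyS, hy⟩ := hex
    obtain ⟨u, hu, v, hv, hvT, huv⟩ := exists_adj_of_ssubset hbi hconn hS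
      (T := {x ∈ S | π x = 0 ∧ ∀ A ∈ Ch, x ∉ A})
      ⟨x, Finset.mem_filter.mpr ⟨hx, hπx, hxA⟩⟩
      (Finset.filter_ssubset.mpr ⟨y, hyS, by
        rintro ⟨h1, h2⟩
        rcases hy with h | ⟨A, hA, hyA⟩
        · exact h h1
        · exact h2 A hA hyA⟩)
    simp only [Finset.mem_filter, not_and, not_forall, not_not] at hu hvT
    by_cases hvA : ∀ A ∈ Ch, v ∉ A
    · have h1 := hfree u hu.1 v hv hu.2.2 hvA huv
      obtain ⟨A, hA, hA'⟩ := hvT hv (by omega)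
      exact hvA A hA hA'
    · push Not at hvA
      obtain ⟨A, hA, hvA⟩ := hvA
      have := hchild A hA v hvA u hu.1 (hu.2.2 A hA) huv.symm
      omega
  have hmem : ∀ B ∈ Ch ∪ ({x ∈ S | π x < 0}).image singleton,
      B ∈ Ch ∨ ∃ x ∈ S, π x < 0 ∧ B = {x} := by
    intro B hB
    simp only [Finset.mem_union, Finset.mem_image, Finset.mem_filter] at hB
    rcases hB with h | ⟨x, ⟨hx, hx'⟩, rfl⟩
    · exact Or.inl h
    · exact Or.inr ⟨x, hx, hx', rfl⟩
  refine ⟨Finset.filter_subset _ _, fun B hB => ?_, fun A hA B hB hAB => ?_, fun B hB => ?_,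
    fun B hB => ?_, fun B hB => ?_, fun x hx hxP => ?_, fun u hu v hv huv => ?_,
    fun B hB u hu v hv hvB huv => ?_⟩
  · rcases hmem B hB with h | ⟨x, hx, -, rfl⟩
    · exact (hCh B h).1
    · simpa using hx
  · rcases hmem A hA with hA | ⟨x, hx, hπx, rfl⟩ <;> rcases hmem B hB with hB | ⟨y, hy, hπy, rfl⟩
    · exact hdisj A hA B hB hAB
    · exact Finset.disjoint_singleton_right.mpr (hnot y hπy.ne A hA)
    · exact Finset.disjoint_singleton_left.mpr (hnot x hπx.ne B hB)
    · exact Finset.disjoint_singleton.mpr fun h => hAB (by rw [h])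
  · rw [Finset.disjoint_left]
    intro z hz hzP
    rw [Finset.mem_filter] at hzP
    rcases hmem B hB with h | ⟨x, hx, hπx, rfl⟩
    · exact hnot z hzP.2.ne' B h hz
    · rw [Finset.mem_singleton.mp hz] at hzP
      omega
  · rcases hmem B hB with h | ⟨x, hx, hπx, rfl⟩
    · exact (hCh B h).2.1
    · simp
  · rcases hmem B hB with h | ⟨x, hx, hπx, rfl⟩
    · exact (hCh B h).2.2.1
    · exact tight_singleton Γ x
  · simp only [Finset.mem_filter, hx, true_and, not_lt] at hxP
    rcases hxP.lt_or_eq with h | h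
    · exact ⟨{x}, by simp [hx, h], by simp⟩
    · obtain ⟨A, hA, hxA⟩ := hcover x hx h
      exact ⟨A, Finset.mem_union_left _ hA, hxA⟩
  · rw [Finset.mem_filter] at hu hv
    have := hfree u hu.1 v hv.1 (hnot u hu.2.ne') (hnot v hv.2.ne') huv
    omega
  · rw [Finset.mem_filter]
    refine ⟨hv, ?_⟩
    rcases hmem B hB with h | ⟨x, hx, hπx, rfl⟩
    · exact hchild B h u hu v hv hvB huv
    · rw [Finset.mem_singleton] at hu
      subst hu
      by_cases hvA : ∀ A ∈ Ch, v ∉ A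
      · have := hfree u hx v hv (hnot u hπx.ne) hvA huv
        omega
      · push Not at hvA
        obtain ⟨A, hA, hvA⟩ := hvA
        have := hchild A hA v hvA u hx (hnot u hπx.ne A hA) huv.symm
        omega

theorem IsRelation.eq_zero_of_minimal {Γ : SimpleGraph V} (hbi : Bicritical Γ)
    (hconn : CutConnected Γ) (hV : Even (Fintype.card V)) (hpm : ∃ m, IsPM Γ m)
    {ms : Multiset (Finset V)} {π : V → ℤ} (hπ : IsRelation Γ ms π) {U : Finset V}
    (hU : IsGoodCut Γ U) (hms : ∀ T ∈ ms, ∀ u ∈ U, ∀ v ∈ U, (u ∈ T ↔ v ∈ T)) :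
    ∀ x ∈ U, π x = 0 := by
  by_contra! hno
  obtain ⟨x, hx, hπx⟩ := hno
  have h0 : ∀ u ∈ U, ∀ v ∈ U, Γ.Adj u v → π u + π v = 0 := fun u hu v hv huv => by
    rw [← hπ u v huv]
    exact sepSum_eq_zero fun T hT => hms T hT u hu v hv
  have hcard : ∀ ρ : V → ℤ, (∀ u ∈ U, ∀ v ∈ U, Γ.Adj u v → ρ u + ρ v = 0) → ρ x ≠ 0 →
      #{x ∈ U | ρ x < 0} = #{x ∈ U | 0 < ρ x} + 1 := by
    intro ρ hρ hρx
    have hB := isBlobBipartition_of_sign hbi hconn (π := ρ) (Ch := ∅)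
      (Or.inr ⟨hU.odd, hU.tight⟩) (by simp) (by simp) (by simp)
      (fun u hu v hv _ _ huv => hρ u hu v hv huv) ⟨x, hx, Or.inl hρx⟩
    rw [Finset.empty_union] at hB
    have := (hB.card_eq_and_not_adj hbi hpm hU.tight (odd_card_compl hV hU.odd) hU.two_le).1
    rwa [Finset.card_image_of_injective _ Finset.singleton_injective] at this
  have h1 := hcard π h0 hπx
  have h2 := hcard (fun v => -π v) (fun u hu v hv huv => by
    have := h0 u hu v hv huv
    omega) (by simpa using hπx)
  simp only [Left.neg_neg_iff, Left.neg_pos_iff] at h2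
  omega
theorem sepSum_val_eq_one {Ch : Finset (Finset V)}
    (hdisj : ∀ A ∈ Ch, ∀ B ∈ Ch, A ≠ B → Disjoint A B)
    {A : Finset V} (hA : A ∈ Ch) {u v : V} (hu : u ∈ A) (hv : ∀ B ∈ Ch, v ∉ B) :
    sepSum Ch.val u v = 1 := by
  rw [sepSum, Finset.sum_map_val, Finset.sum_eq_single_of_mem A hA]
  · simp [sep, hu, hv A hA]
  · intro B hB hBA
    have := Finset.disjoint_right.mp (hdisj B hB A hA hBA) hu
    simp [sep, this, hv B hB]

theorem false_of_isRelation_isLaminar {Γ : SimpleGraph V} (hbi : Bicritical Γ)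
    (hconn : CutConnected Γ) (hV : Even (Fintype.card V)) (hpm : ∃ m, IsPM Γ m) (N : ℕ) :
    ∀ ms π, IsRelation Γ ms π → (∀ S ∈ ms, IsGoodCut Γ S) → ms ≠ 0 → IsLaminar ms →
      (ms.map fun S => #Sᶜ).sum ≤ N → False := by
  induction N using Nat.strong_induction_on with
  | _ N ih =>
  intro ms π hπ hms hne hlam hN
  set fam : Finset (Finset V) := ms.toFinset with hfam
  have hmemfam : ∀ T, T ∈ fam ↔ T ∈ ms := fun T => Multiset.mem_toFinset
  have hssuniv : ∀ T ∈ ms, T ⊂ univ := by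
    intro T hT
    have := (hms T hT).two_le_compl
    refine Finset.ssubset_univ_iff.mpr ?_
    rintro rfl
    simp at this
  obtain ⟨S, hScand, hSmin⟩ := Finset.exists_min_image
    (insert univ {S ∈ fam | ∃ T ∈ fam, T ⊂ S}) Finset.card ⟨_, Finset.mem_insert_self _ _⟩
  have hS' : S = univ ∨ S ∈ ms ∧ ∃ T ∈ ms, T ⊂ S := by
    simpa [hmemfam] using hScand
  set Ch : Finset (Finset V) := {T ∈ fam | T ⊂ S} with hChdef
  have hCh : ∀ T, T ∈ Ch ↔ T ∈ ms ∧ T ⊂ S := fun T => by simp [hChdef, hmemfam]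
  have hChne : ∃ A, A ∈ Ch := by
    rcases hS' with rfl | ⟨-, T, hT, hTS⟩
    · obtain ⟨T, hT⟩ := Multiset.exists_mem_of_ne_zero hne
      exact ⟨T, (hCh T).mpr ⟨hT, hssuniv T hT⟩⟩
    · exact ⟨T, (hCh T).mpr ⟨hT, hTS⟩⟩
  have hmin : ∀ A ∈ Ch, ∀ T ∈ ms, ¬ T ⊂ A := by
    intro A hA T hT hTA
    rw [hCh] at hA
    have h1 := hSmin A (Finset.mem_insert_of_mem (Finset.mem_filter.mpr
      ⟨(hmemfam A).mpr hA.1, T, (hmemfam T).mpr hT, hTA⟩))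
    have h2 := Finset.card_lt_card hA.2
    omega
  have hzero : ∀ A ∈ Ch, ∀ x ∈ A, π x = 0 := by
    intro A hA
    refine hπ.eq_zero_of_minimal hbi hconn hV hpm (hms A ((hCh A).mp hA).1)
      fun T hT u hu v hv => ?_
    rcases hlam T hT A ((hCh A).mp hA).1 with h | h | h
    · simp [Finset.disjoint_right.mp h hu, Finset.disjoint_right.mp h hv]
    · rcases h.eq_or_ssubset with rfl | h
      · simp [hu, hv]
      · exact absurd h (hmin A hA T hT)
    · simp [h hu, h hv]
  have hdisj : ∀ A ∈ Ch, ∀ B ∈ Ch, A ≠ B → Disjoint A B := by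
    intro A hA B hB hAB
    rcases hlam A ((hCh A).mp hA).1 B ((hCh B).mp hB).1 with h | h | h
    · exact h
    · exact absurd (h.ssubset_of_ne hAB) (hmin B hB A ((hCh A).mp hA).1)
    · exact absurd (h.ssubset_of_ne hAB.symm) (hmin A hA B ((hCh B).mp hB).1)
  have hnsep : ∀ T ∈ ms, T ∉ Ch → ∀ u ∈ S, ∀ v ∈ S, (u ∈ T ↔ v ∈ T) := by
    intro T hT hTC u hu v hv
    rw [hCh, not_and] at hTC
    have hsub : S ⊆ T ∨ Disjoint T S := by
      rcases hS' with rfl | ⟨hS, -⟩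
      · exact absurd (hssuniv T hT) (hTC hT)
      · rcases hlam T hT S hS with h | h | h
        · exact Or.inr h
        · rcases h.eq_or_ssubset with rfl | h
          · exact Or.inl subset_rfl
          · exact absurd h (hTC hT)
        · exact Or.inl h
    rcases hsub with h | h
    · simp [h hu, h hv]
    · simp [Finset.disjoint_right.mp h hu, Finset.disjoint_right.mp h hv]
  have hchild : ∀ A ∈ Ch, ∀ u ∈ A, ∀ v ∉ A, Γ.Adj u v → 0 < π v := by
    intro A hA u hu v hv huv
    have h1 := hπ u v huv
    have h2 := sep_le_sepSum ((hCh A).mp hA).1 u v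
    rw [hzero A hA u hu] at h1
    simp only [sep, hu, hv, iff_false, not_true, if_false] at h2
    omega
  have hfree : ∀ u ∈ S, ∀ v ∈ S, (∀ A ∈ Ch, u ∉ A) → (∀ A ∈ Ch, v ∉ A) → Γ.Adj u v →
      π u + π v = 0 := by
    intro u hu v hv huA hvA huv
    rw [← hπ u v huv]
    refine sepSum_eq_zero fun T hT => ?_
    by_cases hTC : T ∈ Ch
    · simp [huA T hTC, hvA T hTC]
    · exact hnsep T hT hTC u hu v hv
  obtain ⟨A₀, hA₀⟩ := hChne
  have hgood : ∀ A ∈ Ch, IsGoodCut Γ A := fun A hA => hms A ((hCh A).mp hA).1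
  have hB := isBlobBipartition_of_sign hbi hconn (π := π) (S := S) (Ch := Ch)
    (hS'.imp_right fun h => ⟨(hms S h.1).odd, (hms S h.1).tight⟩)
    (fun A hA => ⟨((hCh A).mp hA).2.subset, (hgood A hA).odd, (hgood A hA).tight, hzero A hA⟩)
    hdisj (fun A hA u hu v _ => hchild A hA u hu v) hfree (by
      obtain ⟨x, hx⟩ := Finset.card_pos.mp (hgood A₀ hA₀).odd.pos
      exact ⟨x, ((hCh A₀).mp hA₀).2.subset hx, Or.inr ⟨A₀, hA₀, hx⟩⟩)
  set P : Finset V := {x ∈ S | 0 < π x} with hP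
  set ℬ := Ch ∪ ({x ∈ S | π x < 0}).image singleton with hℬ
  have hA₀ℬ : A₀ ∈ ℬ := Finset.mem_union_left _ hA₀
  rcases hS' with rfl | ⟨hS, -⟩
  · obtain ⟨m, hm⟩ := hpm
    have hcard := hB.card_eq_of_univ hm
    have hP1 := hbi.card_barrier_le_one hB.disjoint hB.odd hB.blob_disjoint
      (fun B hB' u hu v hv huv => hB.mem_of_adj B hB' u hu v (Finset.mem_univ v) hv huv) hcard.ge
    have hle : #A₀ᶜ ≤ #P := by
      refine Finset.card_le_card fun x hx => ?_
      by_contra hxP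
      obtain ⟨B, hB', hxB⟩ := hB.cover x (Finset.mem_univ x) hxP
      have : B = A₀ := Finset.card_le_one.mp (by omega) B hB' A₀ hA₀ℬ
      exact Finset.mem_compl.mp hx (this ▸ hxB)
    have := (hgood A₀ hA₀).two_le_compl
    omega
  · have hSg := hms S hS
    have hPS := (hB.card_eq_and_not_adj hbi hpm hSg.tight (odd_card_compl hV hSg.odd)
      hSg.two_le).2
    have hle : Ch.val ≤ ms := (Multiset.le_iff_subset Ch.nodup).mpr fun T hT =>
      ((hCh T).mp hT).1
    obtain ⟨ms₁, hms₁⟩ := Multiset.le_iff_exists_add.mp hle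
    have hsub : ∀ T ∈ S ::ₘ ms₁, T ∈ ms := by
      intro T hT
      rcases Multiset.mem_cons.mp hT with rfl | h
      · exact hS
      · rw [hms₁]
        exact Multiset.mem_add.mpr (Or.inr h)
    refine ih _ ?_ (S ::ₘ ms₁)
      (fun v => π v + if v ∈ S then (if 0 < π v then -1 else if π v < 0 then 1 else 0) else 0) ?_
      (fun T hT => hms T (hsub T hT)) (by simp)
      (fun T hT T' hT' => hlam T (hsub T hT) T' (hsub T' hT')) le_rfl
    · refine lt_of_lt_of_le ?_ hN
      rw [hms₁, Multiset.map_cons, Multiset.sum_cons, Multiset.map_add, Multiset.sum_add,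
        Finset.sum_map_val]
      have h1 : #A₀ᶜ ≤ ∑ T ∈ Ch, #Tᶜ :=
        Finset.single_le_sum (f := fun T : Finset V => #Tᶜ) (fun _ _ => Nat.zero_le _) hA₀
      have h2 := Finset.card_lt_card ((hCh A₀).mp hA₀).2
      have h3 := Finset.card_add_card_compl S
      have h4 := Finset.card_add_card_compl A₀
      omega
    · set g : V → ℤ := fun v =>
        if v ∈ S then (if 0 < π v then -1 else if π v < 0 then 1 else 0) else 0 with hg
      have hnz : ∀ v ∈ S, (∀ A ∈ Ch, v ∉ A) → π v ≠ 0 := by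
        intro v hv hvA h0
        obtain ⟨B, hB', hvB⟩ := hB.cover v hv (by simp [hP, h0])
        rcases Finset.mem_union.mp hB' with h | h
        · exact hvA B h hvB
        · obtain ⟨y, hy, rfl⟩ := Finset.mem_image.mp h
          rw [Finset.mem_singleton.mp hvB] at h0
          exact (Finset.mem_filter.mp hy).2.ne h0
      have hin : ∀ A ∈ Ch, ∀ u ∈ A, ∀ v, Γ.Adj u v → sep S u v - sepSum Ch.val u v = g u + g v := by
        intro A hA u hu v huv
        have hAS := ((hCh A).mp hA).2.subset
        have hgu : g u = 0 := by simp [hg, hzero A hA u hu]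
        by_cases hvA : v ∈ A
        · have hgv : g v = 0 := by simp [hg, hzero A hA v hvA]
          have h0 : sepSum Ch.val u v = 0 := sepSum_eq_zero fun T hT => by
            by_cases hTA : T = A
            · simp [hTA, hu, hvA]
            · have := Finset.disjoint_right.mp (hdisj T hT A hA hTA)
              simp [this hu, this hvA]
          rw [h0, hgu, hgv]
          simp [sep, hAS hu, hAS hvA]
        · have hpos := hchild A hA u hu v hvA huv
          rw [sepSum_val_eq_one hdisj hA hu fun B hB hvB => hpos.ne' (hzero B hB v hvB), hgu]
          by_cases hvS : v ∈ S <;> simp [sep, hg, hAS hu, hvS, hpos]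
      have hadj : ∀ u v, Γ.Adj u v → sep S u v - sepSum Ch.val u v = g u + g v := by
        intro u v huv
        by_cases hu : ∃ A ∈ Ch, u ∈ A
        · obtain ⟨A, hA, hu⟩ := hu
          exact hin A hA u hu v huv
        by_cases hv : ∃ A ∈ Ch, v ∈ A
        · obtain ⟨A, hA, hv⟩ := hv
          have := hin A hA v hv u huv.symm
          simp only [sepSum, sep_comm _ v u] at this
          rw [sepSum, this, add_comm]
        push Not at hu hv
        rw [sepSum_eq_zero fun T hT => by simp [hu T hT, hv T hT]]
        by_cases huS : u ∈ S <;> by_cases hvS : v ∈ S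
        · have h1 := hnz u huS hu
          have h2 := hfree u huS v hvS hu hv huv
          simp only [sep, hg, huS, hvS, if_true]
          split_ifs <;> omega
        · have h1 := hnz u huS hu
          have h2 : ¬ 0 < π u := fun h =>
            hPS u (Finset.mem_filter.mpr ⟨huS, h⟩) v hvS huv
          have h3 : π u < 0 := by omega
          simp [sep, hg, huS, hvS, h2, h3]
        · have h1 := hnz v hvS hv
          have h2 : ¬ 0 < π v := fun h =>
            hPS v (Finset.mem_filter.mpr ⟨hvS, h⟩) u huS huv.symm
          have h3 : π v < 0 := by omega
          simp [sep, hg, huS, hvS, h2, h3]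
        · simp [sep, hg, huS, hvS]
      intro u v huv
      have h1 := hπ u v huv
      have h2 := hadj u v huv
      rw [hms₁, sepSum_add] at h1
      rw [sepSum_cons]
      dsimp only
      linarith

theorem IsPM.even_card {Γ : SimpleGraph V} {m : V → V} (hm : IsPM Γ m) :
    Even (Fintype.card V) :=
  even_card_of_involution hm.1 (T := univ) fun v _ => ⟨Finset.mem_univ _, hm.ne v⟩

theorem Bicritical.exists_isPM_of_cutConnected {Γ : SimpleGraph V} (hbi : Bicritical Γ)
    (hconn : CutConnected Γ) (hV : 2 ≤ Fintype.card V) : ∃ m, IsPM Γ m := by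
  obtain ⟨x, y, hxy⟩ := Fintype.one_lt_card_iff.mp hV
  obtain ⟨u, -, v, -, huv⟩ := hconn {x} x (by simp) y (by simpa using hxy.symm)
  obtain ⟨m, hm, -⟩ := hbi.exists_isPM huv
  exact ⟨m, hm⟩

/-- A bicritical 3-connected graph has no nontrivial tight cuts. -/
theorem not_isGoodCut {Γ : SimpleGraph V} (hbi : Bicritical Γ) (h3 : CutThreeConnected Γ)
    (hV : 4 ≤ Fintype.card V) (X : Finset V) : ¬ IsGoodCut Γ X := by
  intro hX
  have hconn := h3.cutConnected hV
  have hex := hbi.exists_isPM_of_cutConnected hconn (by omega)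
  have heven : Even (Fintype.card V) := hex.elim fun m hm => hm.even_card
  set w : V → V → ℕ := fun u v => if (u ∈ X ↔ v ∈ X) then 0 else 1 with hw
  have hws : ∀ u v, (w u v : ℤ) = sep X u v := fun u v => by
    simp only [hw, sep]
    split_ifs <;> rfl
  obtain ⟨π, ms, h1, -, h2⟩ := exists_dual_of_weight_const (Γ := Γ) (w := w) (k := 2)
    (fun u v => by simp only [hw, iff_comm]) (fun u v => by simp only [hw]; split_ifs <;> omega)
    (fun m hm => by
      simp only [weight, hws, sum_sep hm.1, hX.tight m hm]
      norm_num) hex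
  have hrel : IsRelation Γ (X ::ₘ X ::ₘ ms) π := by
    intro u v huv
    obtain ⟨m, hm, rfl⟩ := hbi.exists_isPM huv
    rw [← h2 m hm u, sepSum_cons, sepSum_cons, hws]
    ring
  obtain ⟨r, -⟩ := Finset.card_pos.mp (lt_of_lt_of_le two_pos hX.two_le)
  obtain ⟨ms₁, π₁, hrel₁, hms₁, -, hne₁⟩ := exists_isRelation_normalized heven r _
    (by simpa using ⟨⟨hX.odd, hX.tight⟩, h1⟩) π hrel
  obtain ⟨ms₂, π₂, hrel₂, hms₂, hne₂, hlam⟩ := exists_isRelation_isLaminar hbi h3 heven r _ ms₁ π₁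
    hrel₁ hms₁ (hne₁ ⟨X, by simp, hX⟩) le_rfl
  exact false_of_isRelation_isLaminar hbi hconn heven hex _ ms₂ π₂ hrel₂ hms₂ hne₂ hlam le_rfl

/-- A bicritical graph with at least four vertices and a perfect matching is not bipartite. -/
theorem Bicritical.not_bipartite {Γ : SimpleGraph V} (hbi : Bicritical Γ) {m : V → V}
    (hm : IsPM Γ m) (hV : 4 ≤ Fintype.card V) :
    ¬ ∃ c : V → Bool, ∀ u v, Γ.Adj u v → c u ≠ c v := by
  rintro ⟨c, hc⟩
  have hcard : #{v | c v = true} = #{v | ¬ c v = true} := by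
    refine Finset.card_bij' (fun x _ => m x) (fun x _ => m x) ?_ ?_ (fun x _ => hm.1 x)
      fun x _ => hm.1 x
    all_goals
      intro x hx
      have := hc _ _ (hm.2 x)
      simp only [Finset.mem_filter, Finset.mem_univ, true_and] at hx ⊢
      grind
  have hsum := Finset.card_filter_add_card_filter_not (s := (univ : Finset V)) (fun v => c v = true)
  have h1 := hbi.card_barrier_le_one (P := {v | c v = true})
    (ℬ := ({v | ¬ c v = true} : Finset V).image singleton) (by
      simp only [Finset.mem_image]
      rintro _ ⟨u, -, rfl⟩ _ ⟨v, -, rfl⟩ huv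
      simpa using fun h => huv (by rw [h]))
    (by
      simp only [Finset.mem_image]
      rintro _ ⟨u, -, rfl⟩
      simp)
    (by
      simp only [Finset.mem_image]
      rintro _ ⟨u, hu, rfl⟩
      simpa using hu)
    (by
      simp only [Finset.mem_image]
      rintro _ ⟨u, hu, rfl⟩ u' hu' v - huv
      rw [Finset.mem_singleton.mp hu'] at huv
      have := hc _ _ huv
      simp only [Finset.mem_filter, Finset.mem_univ, true_and] at hu ⊢
      grind)
    (by rw [Finset.card_image_of_injective _ Finset.singleton_injective, hcard])
  rw [Finset.card_univ] at hsum
  omega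

end Abstract

theorem reflTransGen_iff_exists_cut {α : Type*} {r : α → α → Prop} :
    (∀ u v, Relation.ReflTransGen r u v) ↔
      ∀ T : Set α, ∀ x ∈ T, ∀ y ∉ T, ∃ u ∈ T, ∃ v ∉ T, r u v := by
  constructor
  · intro h T x hx y hy
    by_contra! hno
    refine hy ?_
    clear hy
    induction h x y with
    | refl => exact hx
    | @tail b c _ hbc ih =>
      by_contra hc
      exact hno b ih c hc hbc
  · intro h x y
    by_contra hy
    obtain ⟨u, hu, v, hv, huv⟩ := h {v | Relation.ReflTransGen r x v} x .refl y hy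
    exact hv (Relation.ReflTransGen.tail hu huv)

namespace Multigraph

variable {G : Multigraph}

variable (G) in
/-- The underlying simple graph of a multigraph. -/
def simple : SimpleGraph G.V where
  Adj := G.Adj
  symm := ⟨fun u v ⟨hne, e, he⟩ => ⟨hne.symm, e, by rw [he, Sym2.eq_swap]⟩⟩
  loopless := ⟨fun _ h => h.1 rfl⟩

theorem simple_adj_of_ends {e : G.E} {u v : G.V} (h : G.ends e = s(u, v)) : G.simple.Adj u v :=
  ⟨fun huv => G.no_loops e (by rw [h, huv]; rfl), e, h⟩

/-- The set of edges `M` joins exactly the pairs `v`, `m v`. -/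
def Represents (M : Set G.E) (m : G.V → G.V) : Prop :=
  ∀ u v, (∃ e ∈ M, G.ends e = s(u, v)) ↔ m u = v

theorem IsPerfectMatching.exists_isPM {M : Set G.E} (hM : G.IsPerfectMatching M) :
    ∃ m, IsPM G.simple m ∧ Represents M m := by
  have h : ∀ u, ∃ v, ∃ e ∈ M, G.ends e = s(u, v) := fun u => by
    obtain ⟨e, ⟨heM, v, hv⟩, -⟩ := hM u
    exact ⟨v, e, heM, hv⟩
  choose m c hcM hc using h
  have key : Represents M m := by
    refine fun u v => ⟨?_, ?_⟩
    · rintro ⟨e, he, hev⟩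
      have : e = c u := (hM u).unique ⟨he, by simp [Inc, hev]⟩ ⟨hcM u, by simp [Inc, hc]⟩
      rw [this, hc] at hev
      exact Sym2.congr_right.mp hev
    · rintro rfl
      exact ⟨c u, hcM u, hc u⟩
  refine ⟨m, ⟨fun u => (key _ _).mp ⟨c u, hcM u, by rw [hc, Sym2.eq_swap]⟩, fun u => ?_⟩, key⟩
  exact simple_adj_of_ends (hc u)

theorem exists_isPerfectMatching_of_isPM {m : G.V → G.V} (hm : IsPM G.simple m) {F : Set G.E}
    (hF : Set.InjOn G.ends F) :
    ∃ M, G.IsPerfectMatching M ∧ Represents M m ∧ ∀ e ∈ F, ∀ u, G.ends e = s(u, m u) → e ∈ M := by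
  obtain ⟨R, hFR, hR⟩ := hF.bijOn_image.exists_extend (Set.image_subset_range _ _) le_rfl
  have hex : ∀ u, ∃ e ∈ R, G.ends e = s(u, m u) := fun u => by
    obtain ⟨-, e, he⟩ := hm.2 u
    obtain ⟨f, hf, hfe⟩ := hR.surjOn ⟨e, rfl⟩
    exact ⟨f, hf, hfe.trans he⟩
  have hinc : ∀ e u v, G.ends e = s(v, m v) → u ∈ G.ends e → G.ends e = s(u, m u) := by
    intro e u v he hu
    rw [he, Sym2.mem_iff] at hu
    rcases hu with rfl | rfl
    · exact he
    · rw [he, hm.1, Sym2.eq_swap]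
  refine ⟨{e ∈ R | ∃ v, G.ends e = s(v, m v)}, fun u => ?_, fun u v => ⟨?_, ?_⟩,
    fun e he u hu => ⟨hFR he, u, hu⟩⟩
  · obtain ⟨e, heR, he⟩ := hex u
    refine ⟨e, ⟨⟨heR, u, he⟩, by simp [Inc, he]⟩, ?_⟩
    rintro f ⟨⟨hfR, v, hf⟩, hu⟩
    exact hR.injOn hfR heR ((hinc f u v hf hu).trans he.symm)
  · rintro ⟨e, ⟨-, w, hw⟩, huv⟩
    have := hinc e u w hw (by simp [huv])
    rw [huv] at this
    exact (Sym2.congr_right.mp this).symm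
  · rintro rfl
    obtain ⟨e, heR, he⟩ := hex u
    exact ⟨e, ⟨heR, u, he⟩, he⟩

theorem existsUnique_cut_iff [DecidableEq G.V] {M : Set G.E} {m : G.V → G.V}
    (hM : G.IsPerfectMatching M) (hMm : Represents M m) (S : Finset G.V) :
    (∃! e, e ∈ M ∧ e ∈ G.cut (S : Set G.V)) ↔ crossing S m = 1 := by
  rw [crossing, Finset.card_eq_one]
  constructor
  · rintro ⟨e, ⟨heM, u, hu, w, hw, he⟩, huniq⟩
    have hmu : m u = w := (hMm u w).mp ⟨e, heM, he⟩
    refine ⟨u, ?_⟩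
    ext x
    simp only [Finset.mem_filter, Finset.mem_singleton]
    constructor
    · rintro ⟨hx, hmx⟩
      obtain ⟨f, hf, hfx⟩ := (hMm x _).mpr rfl
      have := huniq f ⟨hf, x, hx, m x, hmx, hfx⟩
      rw [this, he, Sym2.eq_iff] at hfx
      rcases hfx with h | h
      · exact h.1.symm
      · exact absurd (h.1 ▸ hu) hmx
    · rintro rfl
      exact ⟨hu, hmu ▸ hw⟩
  · rintro ⟨a, ha⟩
    have hmem : ∀ x, x ∈ S ∧ m x ∉ S ↔ x = a := fun x => by
      simpa using Finset.ext_iff.mp ha x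
    obtain ⟨e, he, hea⟩ := (hMm a _).mpr rfl
    have ha' := (hmem a).mpr rfl
    refine ⟨e, ⟨he, a, ha'.1, m a, ha'.2, hea⟩, ?_⟩
    rintro f ⟨hf, u, hu, w, hw, hfu⟩
    have hmu := (hMm u w).mp ⟨f, hf, hfu⟩
    have hua := (hmem u).mp ⟨hu, hmu ▸ hw⟩
    refine (hM a).unique ⟨hf, ?_⟩ ⟨he, ?_⟩
    · simp [Inc, hfu, hua]
    · simp [Inc, hea]

theorem isTightCut_coe_iff [DecidableEq G.V] (S : Finset G.V) :
    G.IsTightCut (S : Set G.V) ↔ S.Nonempty ∧ Sᶜ.Nonempty ∧ Tight G.simple S := by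
  rw [IsTightCut, ← Finset.coe_compl, Finset.coe_nonempty, Finset.coe_nonempty]
  refine and_congr_right fun _ => and_congr_right fun _ => ⟨fun h m hm => ?_, fun h M hM => ?_⟩
  · obtain ⟨M, hM, hMm, -⟩ := exists_isPerfectMatching_of_isPM hm (Set.injOn_empty _)
    exact (existsUnique_cut_iff hM hMm S).mp (h M hM)
  · obtain ⟨m, hm, hMm⟩ := hM.exists_isPM
    exact (existsUnique_cut_iff hM hMm S).mpr (h m hm)

theorem trivialShore_coe_iff [DecidableEq G.V] (S : Finset G.V) :
    G.TrivialShore (S : Set G.V) ↔ ∃ a, S = {a} ∨ Sᶜ = {a} := by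
  rw [TrivialShore, ← exists_or]
  simp only [← Finset.coe_compl, ← Finset.coe_singleton, Finset.coe_inj]

theorem bipartite_iff : G.Bipartite ↔ ∃ c : G.V → Bool, ∀ u v, G.simple.Adj u v → c u ≠ c v :=
  exists_congr fun _ => ⟨fun h u v ⟨_, e, he⟩ => h e u v he,
    fun h _ u v he => h u v (simple_adj_of_ends he)⟩

theorem connected_iff : G.Connected ↔ Nonempty G.V ∧ CutConnected G.simple := by
  classical
  rw [Connected, reflTransGen_iff_exists_cut, CutConnected]
  refine and_congr_right fun _ => ⟨fun h T => h T, fun h T => ?_⟩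
  simpa using! h T.toFinset

theorem deleteVerts_ends_eq_iff {S : Set G.V} (e : (G.deleteVerts S).E)
    (u v : (G.deleteVerts S).V) :
    (G.deleteVerts S).ends e = s(u, v) ↔ G.ends e.1 = s(u.1, v.1) := by
  have h : ((G.deleteVerts S).ends e).map Subtype.val = G.ends e.1 :=
    Sym2.attachWith_map_subtypeVal _
  rw [← h]
  exact (Sym2.map.injective Subtype.val_injective).eq_iff.symm

theorem deleteVerts_adj_iff {S : Set G.V} (u v : (G.deleteVerts S).V) :
    (G.deleteVerts S).Adj u v ↔ G.Adj u.1 v.1 := by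
  refine and_congr (not_congr Subtype.ext_iff) ⟨?_, ?_⟩
  · rintro ⟨e, he⟩
    exact ⟨e.1, (deleteVerts_ends_eq_iff e u v).mp he⟩
  · rintro ⟨e, he⟩
    have hmem : ∀ w ∈ G.ends e, w ∉ S := by
      rw [he]
      intro w hw
      rcases Sym2.mem_iff.mp hw with rfl | rfl
      exacts [u.2, v.2]
    exact ⟨⟨e, hmem⟩, (deleteVerts_ends_eq_iff ⟨e, hmem⟩ u v).mpr he⟩

theorem mem_deleteVerts_pair {x y v : G.V} : v ∉ ({x, y} : Set G.V) ↔ v ≠ x ∧ v ≠ y := by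
  simp

theorem deleteVerts_connected_iff {a b : G.V} :
    (G.deleteVerts {a, b}).Connected ↔ (∃ z, z ≠ a ∧ z ≠ b) ∧
      ∀ T : Finset G.V, T.Nonempty → a ∉ T → b ∉ T → (∃ z ∉ T, z ≠ a ∧ z ≠ b) →
        ∃ u ∈ T, ∃ v ∉ T, v ≠ a ∧ v ≠ b ∧ G.simple.Adj u v := by
  classical
  rw [Connected, reflTransGen_iff_exists_cut]
  refine and_congr ?_ ⟨?_, ?_⟩
  · exact ⟨fun ⟨z⟩ => ⟨z.1, mem_deleteVerts_pair.mp z.2⟩,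
      fun ⟨z, hz⟩ => ⟨⟨z, mem_deleteVerts_pair.mpr hz⟩⟩⟩
  · rintro h T ⟨x, hx⟩ ha hb ⟨z, hz, hz'⟩
    have hxab : x ≠ a ∧ x ≠ b := ⟨fun h => ha (h ▸ hx), fun h => hb (h ▸ hx)⟩
    obtain ⟨u, hu, v, hv, huv⟩ := h {w | w.1 ∈ T} ⟨x, mem_deleteVerts_pair.mpr hxab⟩ hx
      ⟨z, mem_deleteVerts_pair.mpr hz'⟩ hz
    have hv' := mem_deleteVerts_pair.mp v.2
    exact ⟨u.1, hu, v.1, hv, hv'.1, hv'.2, (deleteVerts_adj_iff u v).mp huv⟩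
  · intro h T x hx y hy
    have hmem : ∀ w, w ∈ (Subtype.val '' T).toFinset ↔ ∃ w' ∈ T, w'.1 = w := fun w => by
      rw [Set.mem_toFinset]
      rfl
    have hnot : ∀ w ∈ ({a, b} : Set G.V), w ∉ (Subtype.val '' T).toFinset := fun w hw hT => by
      obtain ⟨w', -, rfl⟩ := (hmem w).mp hT
      exact w'.2 hw
    obtain ⟨u, hu, v, hv, hva, hvb, huv⟩ := h (Subtype.val '' T).toFinset
      ⟨x.1, (hmem _).mpr ⟨x, hx, rfl⟩⟩ (hnot a (by simp)) (hnot b (by simp))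
      ⟨y.1, fun hyT => by
        obtain ⟨y', hy', hyy⟩ := (hmem _).mp hyT
        exact hy (Subtype.ext hyy ▸ hy'), mem_deleteVerts_pair.mp y.2⟩
    obtain ⟨u', hu', rfl⟩ := (hmem u).mp hu
    have hv' : v ∉ ({a, b} : Set G.V) := mem_deleteVerts_pair.mpr ⟨hva, hvb⟩
    exact ⟨u', hu', ⟨v, hv'⟩, fun hvT => hv ((hmem v).mpr ⟨_, hvT, rfl⟩),
      (deleteVerts_adj_iff u' ⟨v, hv'⟩).mpr huv⟩

theorem exists_isPerfectMatching_deleteVerts_iff {x y : G.V} (hxy : x ≠ y) :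
    (∃ M, (G.deleteVerts {x, y}).IsPerfectMatching M) ↔
      ∃ m : G.V → G.V, Involutive m ∧ m x = y ∧ ∀ v, v ≠ x → v ≠ y → G.simple.Adj v (m v) := by
  classical
  constructor
  · rintro ⟨M, hM⟩
    obtain ⟨m, hm, -⟩ := hM.exists_isPM
    set n : G.V → G.V := fun v => if h : v ∉ ({x, y} : Set G.V) then (m ⟨v, h⟩).1 else
      if v = x then y else x with hn
    have hn1 : ∀ v (h : v ∉ ({x, y} : Set G.V)), n v = (m ⟨v, h⟩).1 := fun v h => dif_pos h
    have hnx : n x = y := by simp [hn]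
    have hny : n y = x := by simp [hn, hxy.symm]
    refine ⟨n, fun v => ?_, hnx, fun v hvx hvy => ?_⟩
    · by_cases h : v ∉ ({x, y} : Set G.V)
      · rw [hn1 v h, hn1 _ (m ⟨v, h⟩).2]
        exact congrArg Subtype.val (hm.1 ⟨v, h⟩)
      · rcases not_not.mp h with rfl | rfl
        · rw [hnx, hny]
        · rw [hny, hnx]
    · have h := mem_deleteVerts_pair.mpr ⟨hvx, hvy⟩
      rw [hn1 v h]
      exact (deleteVerts_adj_iff ⟨v, h⟩ _).mp (hm.2 ⟨v, h⟩)
  · rintro ⟨m, hm, hmx, hadj⟩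
    have hmy : m y = x := by rw [← hmx, hm]
    have hmem : ∀ v : (G.deleteVerts {x, y}).V, m v.1 ∉ ({x, y} : Set G.V) := fun v => by
      obtain ⟨h1, h2⟩ := mem_deleteVerts_pair.mp v.2
      refine mem_deleteVerts_pair.mpr ⟨fun h => h2 ?_, fun h => h1 ?_⟩
      · rw [← hm v.1, h, hmx]
      · rw [← hm v.1, h, hmy]
    have hn : IsPM (G.deleteVerts {x, y}).simple fun v => ⟨m v.1, hmem v⟩ := by
      refine ⟨fun v => Subtype.ext (hm v.1), fun v => (deleteVerts_adj_iff v _).mpr ?_⟩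
      obtain ⟨h1, h2⟩ := mem_deleteVerts_pair.mp v.2
      exact hadj v.1 h1 h2
    obtain ⟨M, hM, -⟩ := exists_isPerfectMatching_of_isPM hn (Set.injOn_empty _)
    exact ⟨M, hM⟩

theorem threeConnected_iff :
    G.ThreeConnected ↔ 4 ≤ Fintype.card G.V ∧ CutThreeConnected G.simple := by
  classical
  rw [ThreeConnected, Nat.card_eq_fintype_card]
  refine and_congr_right fun hV => forall₃_congr fun a b hab => ?_
  rw [deleteVerts_connected_iff]
  refine and_iff_right ?_
  have hc : 0 < #({a, b}ᶜ : Finset G.V) := by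
    have := Finset.card_le_two (a := a) (b := b)
    rw [Finset.card_compl]
    omega
  obtain ⟨z, hz⟩ := Finset.card_pos.mp hc
  exact ⟨z, by simpa using hz⟩

theorem bicritical_iff :
    (∀ x y : G.V, x ≠ y → ∃ M : Set (G.deleteVerts {x, y}).E,
      (G.deleteVerts {x, y}).IsPerfectMatching M) ↔ Bicritical G.simple :=
  forall₃_congr fun _ _ hxy => exists_isPerfectMatching_deleteVerts_iff hxy

theorem exists_isPerfectMatching_mem_iff :
    (∀ e : G.E, ∃ M, G.IsPerfectMatching M ∧ e ∈ M) ↔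
      ∀ u v, G.simple.Adj u v → ∃ m, IsPM G.simple m ∧ m u = v := by
  constructor
  · rintro h u v ⟨-, e, he⟩
    obtain ⟨M, hM, heM⟩ := h e
    obtain ⟨m, hm, hMm⟩ := hM.exists_isPM
    exact ⟨m, hm, (hMm u v).mp ⟨e, heM, he⟩⟩
  · intro h e
    obtain ⟨u, v, he⟩ := Sym2.exists_eq_mk (G.ends e)
    obtain ⟨m, hm, rfl⟩ := h u v (simple_adj_of_ends he)
    obtain ⟨M, hM, -, hF⟩ := exists_isPerfectMatching_of_isPM hm (Set.injOn_singleton G.ends e)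
    exact ⟨M, hM, hF e rfl u he⟩

theorem isBrick_iff_simple [DecidableEq G.V] :
    G.IsBrick ↔ 2 ≤ Fintype.card G.V ∧ CutConnected G.simple ∧
      (∀ u v, G.simple.Adj u v → ∃ m, IsPM G.simple m ∧ m u = v) ∧
      (¬ ∃ c : G.V → Bool, ∀ u v, G.simple.Adj u v → c u ≠ c v) ∧
      ∀ S, S.Nonempty → Sᶜ.Nonempty → Tight G.simple S → ∃ a, S = {a} ∨ Sᶜ = {a} := by
  have htriv : (∀ X, G.IsTightCut X → G.TrivialShore X) ↔
      ∀ S : Finset G.V, S.Nonempty → Sᶜ.Nonempty → Tight G.simple S →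
        ∃ a, S = {a} ∨ Sᶜ = {a} := by
    constructor
    · intro h S h1 h2 h3
      exact (trivialShore_coe_iff S).mp (h S ((isTightCut_coe_iff S).mpr ⟨h1, h2, h3⟩))
    · intro h X hX
      have hXS : X = (X.toFinite.toFinset : Set G.V) := by simp
      rw [hXS] at hX ⊢
      obtain ⟨h1, h2, h3⟩ := (isTightCut_coe_iff _).mp hX
      exact (trivialShore_coe_iff _).mpr (h _ h1 h2 h3)
  rw [IsBrick, MatchingCovered, connected_iff, exists_isPerfectMatching_mem_iff, bipartite_iff,
    htriv, Nat.card_eq_fintype_card]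
  constructor
  · rintro ⟨⟨h1, ⟨-, h2⟩, h3⟩, h4, h5⟩
    exact ⟨h1, h2, h3, h4, h5⟩
  · rintro ⟨h1, h2, h3, h4, h5⟩
    exact ⟨⟨h1, ⟨Fintype.card_pos_iff.mp (by omega), h2⟩, h3⟩, h4, h5⟩

end Multigraph

/-- A graph with two vertices is bipartite. -/
theorem exists_bipartition_of_card_le_two {V : Type*} [Fintype V] (Γ : SimpleGraph V)
    (hV : Fintype.card V ≤ 2) : ∃ c : V → Bool, ∀ u v, Γ.Adj u v → c u ≠ c v := by
  obtain ⟨f⟩ : Nonempty (V ↪ Bool) := Function.Embedding.nonempty_of_card_le (by simpa using hV)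
  exact ⟨f, fun u v huv h => huv.ne (f.injective h)⟩

end Matching

/-- Edmonds–Lovász–Pulleyblank: `G` is a brick iff `G` is 3-connected and
`G - x - y` has a perfect matching for every pair of distinct vertices `x, y`. -/
theorem isBrick_iff_threeConnected_and_bicritical (G : Multigraph) :
    G.IsBrick ↔
      G.ThreeConnected ∧ ∀ x y : G.V, x ≠ y →
        ∃ M : Set (G.deleteVerts {x, y}).E,
          (G.deleteVerts {x, y}).IsPerfectMatching M := by
  classical
  rw [threeConnected_iff, bicritical_iff, isBrick_iff_simple]
  constructor
  · rintro ⟨h2, hconn, hcov, hbip, htriv⟩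
    obtain ⟨x, y, hxy⟩ := Fintype.one_lt_card_iff.mp h2
    obtain ⟨u, -, v, -, huv⟩ := hconn {x} x (by simp) y (by simpa using hxy.symm)
    obtain ⟨m, hm, -⟩ := hcov u v huv
    have heven := hm.even_card
    have h4 : 4 ≤ Fintype.card G.V := by
      by_contra h
      refine hbip (exists_bipartition_of_card_le_two _ ?_)
      grind
    have htriv' : ∀ S, Odd S.card → Tight G.simple S → ∃ a, S = {a} ∨ Sᶜ = {a} := by
      intro S hS hSt
      exact htriv S (Finset.card_pos.mp hS.pos)
        (Finset.card_pos.mp (odd_card_compl heven hS).pos) hSt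
    have hbi := bicritical_of_tight_trivial hconn hcov hbip htriv'
    exact ⟨⟨h4, cutThreeConnected_of_tight_trivial hbi htriv'⟩, hbi⟩
  · rintro ⟨⟨h4, h3⟩, hbi⟩
    have hconn := h3.cutConnected h4
    obtain ⟨m, hm⟩ := hbi.exists_isPM_of_cutConnected hconn (by omega)
    refine ⟨by omega, hconn, fun u v huv => hbi.exists_isPM huv, hbi.not_bipartite hm h4, ?_⟩
    intro S hS hSc hSt
    by_contra! hno
    have hodd : Odd S.card := by
      rw [← odd_crossing_iff hm.1 hm.ne S, hSt m hm]
      exact odd_one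
    refine not_isGoodCut hbi h3 h4 S ⟨hodd, hSt, ?_, ?_⟩
    · by_contra h
      have := hS.card_pos
      obtain ⟨a, ha⟩ := Finset.card_eq_one.mp (show S.card = 1 by omega)
      exact (hno a).1 ha
    · by_contra h
      have := hSc.card_pos
      obtain ⟨a, ha⟩ := Finset.card_eq_one.mp (show Sᶜ.card = 1 by omega)
      exact (hno a).2 ha
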